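/- arXiv:2007.00065 — 2 statements merged into one kernel-verified Lean document; each statement's English description precedes it below -/
import Mathlib

section
/- Let n ≥ 1 be an integer such that n + 1 is a perfect square. Then the remainder polynomial R_{n,n}(x) of the Wronskian Hermite polynomial He_{(n,n)} is irreducible in ℤ[x]. -/
open Polynomial Finset

/-- Probabilists' Hermite polynomials over `ℤ`:
`He 0 = 1`, `He 1 = X`, `He (n+1) = X * He n - n * He (n-1)`. -/
noncomputable def He : ℕ → Polynomial ℤ
  | 0 => 1
  | 1 => Polynomial.X
  | n + 2 => Polynomial.X * He (n + 1) - Polynomial.C ((n : ℤ) + 1) * He n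

/-- The Wronskian `Wr[He_{n_1}, …, He_{n_r}]` of the Hermite polynomials indexed by
a degree sequence `ns : Fin r → ℕ`; entry `(i,j)` is the `i`-th derivative of `He (ns j)`. -/
noncomputable def wronskHe {r : ℕ} (ns : Fin r → ℕ) : Polynomial ℤ :=
  Matrix.det (Matrix.of fun i j : Fin r =>
    (fun q : Polynomial ℤ => Polynomial.derivative q)^[(i : ℕ)] (He (ns j)))

/-- `Δ(n_λ) = ∏_{i<j} (n_j - n_i)`. -/
def vand {r : ℕ} (ns : Fin r → ℕ) : ℤ :=
  ∏ j : Fin r, ∏ i ∈ Finset.Iio j, ((ns j : ℤ) - (ns i : ℤ))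

/-- The degree sequence `n_λ` of a partition `λ = (λ_1 ≥ … ≥ λ_r)`,
`n_i = λ_{r+1-i} + (i-1)` (indices shifted to start at `0`). -/
def degSeq {r : ℕ} (lam : Fin r → ℕ) : Fin r → ℕ :=
  fun i => lam i.rev + (i : ℕ)

/-- `d_λ` = (number of odd entries of the degree sequence) − (number of even entries). -/
def dStat {r : ℕ} (ns : Fin r → ℕ) : ℤ :=
  ((Finset.univ.filter fun i => Odd (ns i)).card : ℤ) -
    ((Finset.univ.filter fun i => Even (ns i)).card : ℤ)

/-- `s_λ = d_λ(d_λ+1)/2`, the size of the 2-core of `λ`. -/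
def sStat {r : ℕ} (ns : Fin r → ℕ) : ℕ :=
  (dStat ns * (dStat ns + 1) / 2).toNat


theorem hermite_derivative_succ (n : ℕ) :
    derivative (hermite (n + 1)) = C ((n : ℤ) + 1) * hermite n := by
  induction n with
  | zero => simp [hermite_succ]
  | succ n ih =>
    rw [hermite_succ (n + 1), derivative_sub, derivative_mul, ih, derivative_C_mul,
      derivative_X, hermite_succ n]
    simp only [C_add, Nat.cast_add, Nat.cast_one, C_1]
    ring

theorem hermite_add_two (n : ℕ) :
    hermite (n + 2) = X * hermite (n + 1) - C ((n : ℤ) + 1) * hermite n := by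
  rw [hermite_succ (n + 1), hermite_derivative_succ]

theorem he_eq_hermite : ∀ n, He n = hermite n
  | 0 => by simp [He]
  | 1 => by simp [He]
  | n + 2 => by rw [He, he_eq_hermite (n + 1), he_eq_hermite n, hermite_add_two]

/-- The Wronskian of two consecutive Hermite polynomials, written through the first of them. -/
noncomputable def diagWronskian (n : ℕ) : ℤ[X] :=
  C ((n : ℤ) + 1) * hermite n ^ 2 - X * hermite n * derivative (hermite n)
    + derivative (hermite n) ^ 2

theorem degSeq_diag_zero (n : ℕ) : degSeq ![n, n] 0 = n := by simp [degSeq]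

theorem degSeq_diag_one (n : ℕ) : degSeq ![n, n] 1 = n + 1 := by simp [degSeq]

theorem wronskHe_degSeq_diag (n : ℕ) : wronskHe (degSeq ![n, n]) = diagWronskian n := by
  rw [wronskHe, Matrix.det_fin_two]
  simp only [Matrix.of_apply, degSeq_diag_zero, degSeq_diag_one, he_eq_hermite, Fin.val_zero,
    Fin.val_one, Function.iterate_zero, Function.iterate_one, id, diagWronskian,
    hermite_derivative_succ]
  rw [hermite_succ]
  ring

theorem vand_degSeq_diag (n : ℕ) : vand (degSeq ![n, n]) = 1 := by
  have h0 : Finset.Iio (0 : Fin 2) = ∅ := by decide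
  have h1 : Finset.Iio (1 : Fin 2) = {0} := by decide
  simp [vand, Fin.prod_univ_two, h0, h1, degSeq_diag_zero, degSeq_diag_one]

theorem sStat_degSeq_diag (n : ℕ) : sStat (degSeq ![n, n]) = 0 := by
  have : dStat (degSeq ![n, n]) = 0 := by
    rw [dStat]
    simp only [Finset.card_filter, Fin.sum_univ_two, degSeq_diag_zero, degSeq_diag_one]
    rcases Nat.even_or_odd n with h | h
    · simp [h, h.add_one, Nat.not_odd_iff_even.2 h, Nat.not_even_iff_odd.2 h.add_one]
    · simp [h, h.add_one, Nat.not_odd_iff_even.2 h.add_one, Nat.not_even_iff_odd.2 h]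
  simp [sStat, this]

theorem hermite_comp_neg_X (n : ℕ) : (hermite n).comp (-X) = (-1) ^ n * hermite n := by
  induction n using Nat.twoStepInduction with
  | zero => simp
  | one => simp
  | more n h0 h1 =>
    rw [hermite_add_two, sub_comp, mul_comp, mul_comp, h0, h1, C_comp, X_comp]
    ring

theorem derivative_hermite_comp_neg_X (n : ℕ) :
    (derivative (hermite n)).comp (-X) = -((-1) ^ n * derivative (hermite n)) := by
  cases n with
  | zero => simp
  | succ n =>
    rw [hermite_derivative_succ, mul_comp, C_comp, hermite_comp_neg_X]
    ring

theorem diagWronskian_comp_neg_X (n : ℕ) :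
    (diagWronskian n).comp (-X) = diagWronskian n := by
  have h : ((-1 : ℤ[X]) ^ n) ^ 2 = 1 := by rw [← pow_mul, mul_comm, pow_mul]; simp
  simp only [diagWronskian, add_comp, sub_comp, mul_comp, pow_comp, C_comp, X_comp,
    hermite_comp_neg_X, derivative_hermite_comp_neg_X]
  linear_combination (C ((n : ℤ) + 1) * hermite n ^ 2 - X * hermite n * derivative (hermite n)
    + derivative (hermite n) ^ 2) * h

theorem coeff_eq_zero_of_comp_neg_X {f : ℤ[X]} (h : f.comp (-X) = f) {k : ℕ} (hk : Odd k) :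
    f.coeff k = 0 := by
  have h1 : (f.comp (-X)).coeff k = (-1) ^ k * f.coeff k := by
    rw [show (-X : ℤ[X]) = C (-1) * X by simp, comp_C_mul_X_coeff, mul_comm]
  rw [h, hk.neg_one_pow] at h1
  omega

theorem expand_contract_of_comp_neg_X {f : ℤ[X]} (h : f.comp (-X) = f) :
    expand ℤ 2 (contract 2 f) = f := by
  ext k
  rw [coeff_expand two_pos, coeff_contract two_ne_zero]
  split_ifs with hk
  · rw [Nat.div_mul_cancel hk]
  · exact (coeff_eq_zero_of_comp_neg_X h (Nat.not_even_iff_odd.1 fun h => hk h.two_dvd)).symm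

theorem natDegree_derivative_hermite_le (n : ℕ) : (derivative (hermite n)).natDegree ≤ n - 1 :=
  (natDegree_derivative_le _).trans (by rw [natDegree_hermite])

theorem natDegree_diagWronskian_le (n : ℕ) : (diagWronskian n).natDegree ≤ n + n := by
  rcases Nat.eq_zero_or_pos n with rfl | hn
  · simp [diagWronskian]
  have h' := natDegree_derivative_hermite_le n
  have h := (natDegree_hermite (n := n)).le
  refine natDegree_add_le_of_degree_le ((natDegree_sub_le_iff_left ?_).2 ?_) ?_
  · exact (natDegree_mul_le_of_le (natDegree_mul_le_of_le natDegree_X_le h) h').trans (by omega)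
  · refine (natDegree_C_mul_le _ _).trans (natDegree_pow_le_of_le 2 h |>.trans (by omega))
  · exact (natDegree_pow_le_of_le 2 h').trans (by omega)

theorem coeff_diagWronskian_top {n : ℕ} (hn : 1 ≤ n) : (diagWronskian n).coeff (n + n) = 1 := by
  obtain ⟨m, rfl⟩ : ∃ m, n = m + 1 := ⟨n - 1, by omega⟩
  have hc (k : ℕ) : (hermite k).coeff k = 1 := coeff_hermite_self k
  have h1 : (hermite (m + 1) ^ 2).coeff (m + 1 + (m + 1)) = 1 := by
    rw [pow_two, coeff_mul_add_eq_of_natDegree_le natDegree_hermite.le natDegree_hermite.le, hc, mul_one]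
  have h2 : (X * hermite (m + 1) * hermite m).coeff (m + 1 + (m + 1)) = 1 := by
    rw [mul_assoc, ← add_assoc, coeff_X_mul,
      coeff_mul_add_eq_of_natDegree_le natDegree_hermite.le natDegree_hermite.le, hc, hc, mul_one]
  have h3 : (hermite m ^ 2).coeff (m + 1 + (m + 1)) = 0 := by
    refine coeff_eq_zero_of_natDegree_lt
      ((natDegree_pow_le_of_le 2 natDegree_hermite.le).trans_lt (by omega))
  have : diagWronskian (m + 1) = C ((m : ℤ) + 2) * hermite (m + 1) ^ 2
      - C ((m : ℤ) + 1) * (X * hermite (m + 1) * hermite m)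
      + C (((m : ℤ) + 1) ^ 2) * hermite m ^ 2 := by
    rw [diagWronskian, hermite_derivative_succ]
    push_cast
    simp only [C_add, C_pow, C_1, map_natCast, map_ofNat]
    ring
  rw [this, coeff_add, coeff_sub, coeff_C_mul, coeff_C_mul, coeff_C_mul, h1, h2, h3]
  ring

theorem monic_diagWronskian {n : ℕ} (hn : 1 ≤ n) : (diagWronskian n).Monic :=
  monic_of_natDegree_le_of_coeff_eq_one _ (natDegree_diagWronskian_le n)
    (coeff_diagWronskian_top hn)

/-- The polynomial `F` with `F(x²)` equal to the Wronskian. -/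
noncomputable def diagContract (n : ℕ) : ℤ[X] := contract 2 (diagWronskian n)

theorem expand_diagContract (n : ℕ) : expand ℤ 2 (diagContract n) = diagWronskian n :=
  expand_contract_of_comp_neg_X (diagWronskian_comp_neg_X n)

theorem monic_diagContract {n : ℕ} (hn : 1 ≤ n) : (diagContract n).Monic := by
  rw [← Polynomial.monic_expand_iff two_pos, expand_diagContract]
  exact monic_diagWronskian hn

theorem natDegree_diagWronskian {n : ℕ} (hn : 1 ≤ n) : (diagWronskian n).natDegree = n + n := by
  refine le_antisymm (natDegree_diagWronskian_le n) (le_natDegree_of_ne_zero ?_)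
  rw [coeff_diagWronskian_top hn]
  exact one_ne_zero

theorem natDegree_diagContract {n : ℕ} (hn : 1 ≤ n) : (diagContract n).natDegree = n := by
  have := natDegree_diagWronskian hn
  rw [← expand_diagContract, natDegree_expand] at this
  omega

section ModPrime

variable (p : ℕ) [hp : Fact p.Prime]

theorem map_hermite_prime (hodd : Odd p) :
    (hermite p).map (Int.castRingHom (ZMod p)) = X ^ p := by
  ext k
  rw [coeff_map, coeff_X_pow]
  split_ifs with hk
  · simp [hk]
  · rcases lt_or_gt_of_ne hk with hlt | hgt
    · rcases Nat.even_or_odd (p + k) with he | ho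
      · rw [coeff_hermite_of_even_add he]
        have hk0 : k ≠ 0 := by
          rintro rfl
          exact Nat.not_even_iff_odd.2 hodd (by simpa using he)
        have : ((p.choose k : ℕ) : ZMod p) = 0 :=
          (ZMod.natCast_eq_zero_iff _ _).2 (hp.out.dvd_choose_self hk0 hlt)
        simp [this]
      · rw [coeff_hermite_of_odd_add ho, map_zero]
    · rw [coeff_hermite_of_lt hgt, map_zero]

theorem map_hermite_add_prime (hodd : Odd p) (n : ℕ) :
    (hermite (n + p)).map (Int.castRingHom (ZMod p)) =
      X ^ p * (hermite n).map (Int.castRingHom (ZMod p)) := by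
  induction n using Nat.twoStepInduction with
  | zero => simp [map_hermite_prime p hodd]
  | one =>
    obtain ⟨m, hm⟩ : ∃ m, p = m + 1 := ⟨p - 1, by have := hp.out.pos; omega⟩
    have h := map_hermite_prime p hodd
    have h2 : ((m : ZMod p) + 1) = 0 := by
      exact_mod_cast (ZMod.natCast_eq_zero_iff (m + 1) p).2 hm.dvd
    rw [show 1 + p = m + 2 by omega, hermite_add_two, ← hm, hermite_one]
    simp only [Polynomial.map_sub, Polynomial.map_mul, Polynomial.map_X, h, Polynomial.map_C]
    simp [h2, mul_comm]
  | more n h0 h1 =>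
    rw [show n + 2 + p = n + p + 2 by omega, hermite_add_two, hermite_add_two,
      show n + p + 1 = n + 1 + p by omega]
    simp only [Polynomial.map_sub, Polynomial.map_mul, Polynomial.map_X, h0, h1, Polynomial.map_C]
    simp
    ring

theorem map_diagWronskian_add_prime (hodd : Odd p) (n : ℕ) :
    (diagWronskian (n + p)).map (Int.castRingHom (ZMod p)) =
      X ^ (2 * p) * (diagWronskian n).map (Int.castRingHom (ZMod p)) := by
  simp only [diagWronskian, Polynomial.map_add, Polynomial.map_sub, Polynomial.map_mul,
    Polynomial.map_pow, Polynomial.map_X, ← derivative_map, map_hermite_add_prime p hodd,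
    Polynomial.map_C, derivative_mul, derivative_X_pow]
  simp
  ring

theorem map_diagWronskian_mul_prime_add (hodd : Odd p) (q u : ℕ) :
    (diagWronskian (q * p + u)).map (Int.castRingHom (ZMod p)) =
      X ^ (2 * (q * p)) * (diagWronskian u).map (Int.castRingHom (ZMod p)) := by
  induction q with
  | zero => simp
  | succ q ih =>
    rw [show (q + 1) * p + u = q * p + u + p by ring, map_diagWronskian_add_prime p hodd, ih]
    ring

theorem map_diagContract_mul_prime_add (hodd : Odd p) (q u : ℕ) :
    (diagContract (q * p + u)).map (Int.castRingHom (ZMod p)) =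
      X ^ (q * p) * (diagContract u).map (Int.castRingHom (ZMod p)) := by
  apply expand_injective two_pos
  rw [map_mul, ← map_expand, ← map_expand, expand_diagContract, expand_diagContract,
    map_diagWronskian_mul_prime_add p hodd, map_pow, expand_X]
  ring

end ModPrime

theorem Nat.exists_prime_mod_four_eq_three {n : ℕ} (hn : n % 4 = 3) :
    ∃ p, p.Prime ∧ p ∣ n ∧ p % 4 = 3 := by
  induction n using Nat.strong_induction_on with
  | _ n ih =>
    obtain ⟨p, hp, m, rfl⟩ := Nat.exists_prime_and_dvd (n := n) (by omega)
    by_cases h3 : p % 4 = 3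
    · exact ⟨p, hp, dvd_mul_right _ _, h3⟩
    have hm0 : 0 < m := by
      rcases Nat.eq_zero_or_pos m with rfl | h
      · simp at hn
      · exact h
    have hm : m % 4 = 3 := by
      rw [Nat.mul_mod] at hn
      have h1 : p % 4 < 4 := Nat.mod_lt _ (by norm_num)
      have h2 : m % 4 < 4 := Nat.mod_lt _ (by norm_num)
      interval_cases p % 4 <;> interval_cases m % 4 <;> simp_all
    obtain ⟨r, hr, hd, h⟩ := ih m (lt_mul_left hm0 hp.one_lt) hm
    exact ⟨r, hr, hd.mul_left _, h⟩

theorem diagWronskian_coeff_zero_nonneg (n : ℕ) : 0 ≤ (diagWronskian n).coeff 0 := by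
  simp only [diagWronskian, coeff_add, coeff_sub, mul_assoc, mul_coeff_zero, coeff_X_zero,
    pow_two, coeff_C_zero]
  nlinarith [mul_self_nonneg ((hermite n).coeff 0), mul_self_nonneg ((derivative (hermite n)).coeff 0)]


theorem irreducible_X_sq_add_one_zmod {p : ℕ} [Fact p.Prime] (hp : p % 4 = 3) :
    Irreducible (X ^ 2 + 1 : (ZMod p)[X]) := by
  have hd : (X ^ 2 + 1 : (ZMod p)[X]).natDegree = 2 := by compute_degree!
  refine (irreducible_iff_roots_eq_zero_of_degree_le_three hd.ge (by omega)).2 ?_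
  refine Multiset.eq_zero_of_forall_notMem fun a ha => ?_
  have h := isRoot_of_mem_roots ha
  rw [IsRoot.def, eval_add, eval_pow, eval_X, eval_one] at h
  exact ZMod.exists_sq_eq_neg_one_iff.1 ⟨a, by linear_combination -h⟩ hp

theorem map_diagWronskian_one {R : Type*} [CommRing R] (f : ℤ →+* R) :
    (diagWronskian 1).map f = X ^ 2 + 1 := by
  have : diagWronskian 1 = X ^ 2 + 1 := by
    simp [diagWronskian]
    ring
  simp [this]

/-- Comparison of `g(x) g(-x)` with the Wronskian, when the contracted polynomial is irreducible. -/
theorem mul_comp_neg_X_eq_of_dvd {n : ℕ} (hn : 1 ≤ n) (hF : Irreducible (diagContract n))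
    {g : ℤ[X]} (hg : g.Monic) (hg0 : 0 < g.natDegree) (hgn : g.natDegree ≤ n)
    (hd : g ∣ diagWronskian n) :
    g.natDegree = n ∧ (g * g.comp (-X) = diagWronskian n ∨
      g * g.comp (-X) = -diagWronskian n) := by
  obtain ⟨f, hf⟩ := hd
  have hcomp (g : ℤ[X]) : (g * g.comp (-X)).comp (-X) = g * g.comp (-X) := by
    rw [mul_comp, comp_neg_X_comp_neg_X, mul_comm]
  have hNg := expand_contract_of_comp_neg_X (hcomp g)
  have hNf := expand_contract_of_comp_neg_X (hcomp f)
  set N := contract 2 (g * g.comp (-X)) with hN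
  set M := contract 2 (f * f.comp (-X)) with hM
  have hNM : N * M = diagContract n ^ 2 := by
    apply expand_injective two_pos
    rw [map_mul, map_pow, hNg, hNf, expand_diagContract, pow_two]
    nth_rw 2 [← diagWronskian_comp_neg_X]
    rw [hf, mul_comp]
    ring
  have hgc : g.comp (-X) ≠ 0 := fun h => hg.ne_zero (comp_neg_X_eq_zero_iff.1 h)
  have hNd : N.natDegree = g.natDegree := by
    have h : (expand ℤ 2 N).natDegree = (g * g.comp (-X)).natDegree := by rw [hNg]
    rw [natDegree_expand, natDegree_mul hg.ne_zero hgc, natDegree_comp, natDegree_neg,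
      natDegree_X] at h
    omega
  obtain ⟨i, hi, hass⟩ := (dvd_prime_pow hF.prime 2).1 (Dvd.intro _ hNM)
  obtain ⟨u, hu⟩ := hass
  obtain ⟨r, hr, hru⟩ := Polynomial.isUnit_iff.1 u.isUnit
  rw [← hru] at hu
  have hr' := Int.isUnit_iff.1 hr
  have hr0 : r ≠ 0 := hr.ne_zero
  have hdeg : N.natDegree = i * n := by
    have h : (N * C r).natDegree = (diagContract n ^ i).natDegree := by rw [hu]
    rwa [natDegree_mul_C hr0, natDegree_pow, natDegree_diagContract hn] at h
  have hi1 : i = 1 := by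
    interval_cases i <;> omega
  subst hi1
  refine ⟨by omega, ?_⟩
  rw [pow_one] at hu
  have h := congrArg (expand ℤ 2) hu
  rw [map_mul, hNg, expand_C, expand_diagContract] at h
  rcases hr' with rfl | rfl
  · left; simpa using h
  · right; rw [← h]; simp

theorem irreducible_diagWronskian {n k : ℕ} (hn : 1 ≤ n) (hk : n + 1 = k ^ 2)
    (h0 : (diagWronskian n).coeff 0 ≠ 0) (hF : Irreducible (diagContract n)) :
    Irreducible (diagWronskian n) := by
  have hW := monic_diagWronskian hn
  have hWd := natDegree_diagWronskian hn
  refine (hW.irreducible_iff_lt_natDegree_lt ?_).2 fun g hg hgd hdvd => ?_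
  · intro h
    rw [h, natDegree_one] at hWd
    omega
  rw [hWd, Finset.mem_Ioc] at hgd
  obtain ⟨hgn, heq⟩ := mul_comp_neg_X_eq_of_dvd hn hF hg hgd.1 (by omega) hdvd
  rcases Nat.even_or_odd n with he | ho
  · have hn3 : (n - 1) % 4 = 3 := by
      have h2 : k % 2 = 1 := by
        by_contra h
        have : Even (k ^ 2) := (Nat.even_iff.2 (by omega)).pow_of_ne_zero two_ne_zero
        rw [← hk] at this
        exact Nat.not_even_iff_odd.2 he.add_one this
      obtain ⟨m, rfl⟩ : ∃ m, k = 2 * m + 1 := ⟨k / 2, by omega⟩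
      have : n = 4 * (m ^ 2 + m) := by nlinarith
      omega
    obtain ⟨p, hp, ⟨q, hq⟩, hp4⟩ := Nat.exists_prime_mod_four_eq_three hn3
    have : Fact p.Prime := ⟨hp⟩
    have hpo : Odd p := Nat.odd_iff.2 (by omega)
    have hmap := map_diagWronskian_mul_prime_add p hpo q 1
    rw [show q * p + 1 = n by rw [mul_comm]; omega, map_diagWronskian_one] at hmap
    have hirr := irreducible_X_sq_add_one_zmod hp4
    set P : (ZMod p)[X] := X ^ 2 + 1 with hP
    have hPc : P.comp (-X) = P := by simp [hP]
    set G := g.map (Int.castRingHom (ZMod p)) with hG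
    have hGW : P ∣ G * G.comp (-X) ∧ G * G.comp (-X) ∣ X ^ (2 * (q * p)) * P := by
      have : G * G.comp (-X) = (g * g.comp (-X)).map (Int.castRingHom (ZMod p)) := by
        rw [Polynomial.map_mul, Polynomial.map_comp, Polynomial.map_neg, Polynomial.map_X]
      rcases heq with h | h
      · rw [this, h, hmap]
        exact ⟨dvd_mul_left _ _, dvd_rfl⟩
      · rw [this, h, Polynomial.map_neg, hmap, dvd_neg, neg_dvd]
        exact ⟨dvd_mul_left _ _, dvd_rfl⟩
    have hboth : P ∣ G ∧ P ∣ G.comp (-X) := by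
      have hiff : P ∣ G.comp (-X) ↔ P ∣ G := by rw [dvd_comp_neg_X_iff, hPc]
      rcases hirr.prime.dvd_or_dvd hGW.1 with h | h
      · exact ⟨h, hiff.2 h⟩
      · exact ⟨hiff.1 h, h⟩
    have hdP := (mul_dvd_mul hboth.1 hboth.2).trans hGW.2
    have hPX := hirr.prime.dvd_of_dvd_pow ((mul_dvd_mul_iff_right hirr.ne_zero).1 hdP)
    have hle := natDegree_le_of_dvd hPX X_ne_zero
    have hd : P.natDegree = 2 := by rw [hP]; compute_degree!
    rw [hd, natDegree_X] at hle
    omega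
  · rcases heq with h | h
    · have hl := congrArg leadingCoeff h
      rw [leadingCoeff_mul, comp_neg_X_leadingCoeff_eq, hg.leadingCoeff, hgn, ho.neg_one_pow,
        hW.leadingCoeff] at hl
      norm_num at hl
    · have hc := congrArg (eval 0) h
      rw [eval_mul, eval_comp, eval_neg, eval_neg, eval_X, neg_zero,
        ← coeff_zero_eq_eval_zero, ← coeff_zero_eq_eval_zero] at hc
      have := diagWronskian_coeff_zero_nonneg n
      nlinarith [mul_self_nonneg (g.coeff 0), lt_of_le_of_ne this h0.symm]

section DoubleFactorial

open Nat

/-- The product of the first `t` odd numbers. -/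
def oddProd (t : ℕ) : ℕ := (2 * t - 1)‼

theorem oddProd_zero : oddProd 0 = 1 := rfl

theorem oddProd_succ (t : ℕ) : oddProd (t + 1) = (2 * t + 1) * oddProd t := by
  cases t with
  | zero => rfl
  | succ t =>
    rw [oddProd, oddProd, show 2 * (t + 1 + 1) - 1 = 2 * t + 1 + 2 by omega,
      Nat.doubleFactorial_add_two, show 2 * (t + 1) - 1 = 2 * t + 1 by omega,
      show 2 * t + 1 + 2 = 2 * (t + 1) + 1 by omega]

theorem oddProd_pos (t : ℕ) : 0 < oddProd t := Nat.doubleFactorial_pos _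

theorem oddProd_mul (t : ℕ) : oddProd t * (2 ^ t * t !) = (2 * t)! := by
  induction t with
  | zero => rfl
  | succ t ih =>
    rw [oddProd_succ, show 2 * (t + 1) = 2 * t + 1 + 1 by ring, factorial_succ, factorial_succ,
      factorial_succ, ← ih]
    ring

theorem oddProd_succ_mul (t : ℕ) : oddProd (t + 1) * (2 ^ t * t !) = (2 * t + 1)! := by
  rw [oddProd_succ, factorial_succ, ← oddProd_mul]
  ring

theorem oddProd_mul_choose_even (i t : ℕ) :
    oddProd i * (2 * (i + t)).choose (2 * t) * oddProd t =
      oddProd (i + t) * (i + t).choose t := by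
  have h1 := Nat.choose_mul_factorial_mul_factorial (n := 2 * (i + t)) (k := 2 * t) (by omega)
  have h2 := Nat.choose_mul_factorial_mul_factorial (n := i + t) (k := t) (by omega)
  rw [show 2 * (i + t) - 2 * t = 2 * i by omega, ← oddProd_mul, ← oddProd_mul, ← oddProd_mul,
    ← h2, Nat.add_sub_cancel] at h1
  have h3 : 0 < 2 ^ i * 2 ^ t * i ! * t ! := by positivity
  refine Nat.eq_of_mul_eq_mul_right h3 ?_
  rw [pow_add] at h1
  linear_combination h1

theorem oddProd_mul_choose_odd (i t : ℕ) :
    oddProd i * (2 * (i + t) + 1).choose (2 * t + 1) * oddProd (t + 1) =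
      oddProd (i + t + 1) * (i + t).choose t := by
  have h1 := Nat.choose_mul_factorial_mul_factorial
    (n := 2 * (i + t) + 1) (k := 2 * t + 1) (by omega)
  have h2 := Nat.choose_mul_factorial_mul_factorial (n := i + t) (k := t) (by omega)
  rw [show 2 * (i + t) + 1 - (2 * t + 1) = 2 * i by omega, ← oddProd_mul, ← oddProd_succ_mul,
    ← oddProd_succ_mul, ← h2, Nat.add_sub_cancel] at h1
  have h3 : 0 < 2 ^ i * 2 ^ t * i ! * t ! := by positivity
  refine Nat.eq_of_mul_eq_mul_right h3 ?_
  rw [pow_add] at h1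
  linear_combination h1

variable (p : ℕ) [hp : Fact p.Prime]

theorem padicValNat_oddProd_succ (t : ℕ) :
    padicValNat p (oddProd (t + 1)) = padicValNat p (oddProd t) + padicValNat p (2 * t + 1) := by
  rw [oddProd_succ, padicValNat.mul (by omega) (oddProd_pos t).ne', add_comm]

theorem sub_one_mul_padicValNat_oddProd_le (a : ℕ) :
    (p - 1) * padicValNat p (oddProd (a + 1)) ≤ 2 * a := by
  have hd : oddProd (a + 1) ∣ (2 * a + 1)! := ⟨_, (oddProd_succ_mul a).symm⟩
  have h1 := (padicValNat_dvd_iff_le (p := p) (Nat.factorial_pos _).ne').1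
    (pow_padicValNat_dvd.trans hd)
  have h2 := sub_one_mul_padicValNat_factorial (p := p) (2 * a + 1)
  have h3 : 0 < (p.digits (2 * a + 1)).sum := by
    rw [Nat.pos_iff_ne_zero]
    intro h
    have hz : ∀ x ∈ p.digits (2 * a + 1), x = 0 := by
      intro x hx
      exact Nat.le_zero.1 (h ▸ List.single_le_sum (fun _ _ => Nat.zero_le _) x hx)
    have hne : p.digits (2 * a + 1) ≠ [] := Nat.digits_ne_nil_iff_ne_zero.2 (by omega)
    exact Nat.getLast_digit_ne_zero p (m := 2 * a + 1) (by omega) (hz _ (List.getLast_mem hne))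
  calc _ ≤ (p - 1) * padicValNat p (2 * a + 1)! := Nat.mul_le_mul_left _ h1
    _ ≤ 2 * a := by rw [h2]; omega

variable {p} {h : ℕ} (hph : p = 2 * h + 1)
include hph

theorem padicValNat_oddProd_eq_zero {t : ℕ} (ht : t ≤ h) : padicValNat p (oddProd t) = 0 := by
  refine padicValNat.eq_zero_of_not_dvd fun hd => ?_
  have := (hp.out.dvd_factorial).1 (hd.trans ⟨_, (oddProd_mul t).symm⟩)
  omega

theorem padicValNat_oddProd_const (a : ℕ) {t : ℕ} (ht : t < p) :
    padicValNat p (oddProd (h + 1 + a * p + t)) = padicValNat p (oddProd (h + 1 + a * p)) := by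
  induction t with
  | zero => rfl
  | succ t ih =>
    rw [← ih (by omega), ← add_assoc, padicValNat_oddProd_succ,
      padicValNat.eq_zero_of_not_dvd (n := 2 * (h + 1 + a * p + t) + 1), add_zero]
    rw [show 2 * (h + 1 + a * p + t) + 1 = 2 * (t + 1) + p * (1 + 2 * a) by rw [hph]; ring]
    rw [Nat.dvd_add_left (dvd_mul_right _ _), hp.out.dvd_mul]
    rintro (h2 | h2)
    · have := Nat.le_of_dvd two_pos h2
      have := hp.out.two_le
      omega
    · have := Nat.le_of_dvd (by omega) h2
      omega

theorem padicValNat_oddProd_add_mul (a : ℕ) :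
    padicValNat p (oddProd (h + 1 + a * p)) = a + 1 + padicValNat p (oddProd (a + 1)) := by
  have key (a : ℕ) : padicValNat p (2 * (h + a * p) + 1) = 1 + padicValNat p (2 * a + 1) := by
    rw [show 2 * (h + a * p) + 1 = p * (2 * a + 1) by rw [hph]; ring,
      padicValNat.mul hp.out.ne_zero (by omega), padicValNat_self]
  induction a with
  | zero =>
    have := key 0
    rw [show h + 1 + 0 * p = h + 0 * p + 1 by ring, padicValNat_oddProd_succ, key,
      zero_mul, add_zero, padicValNat_oddProd_eq_zero hph le_rfl, padicValNat_oddProd_succ,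
      oddProd_zero]
    simp
  | succ a ih =>
    rw [show h + 1 + (a + 1) * p = (h + (a + 1) * p) + 1 by ring, padicValNat_oddProd_succ, key,
      show h + (a + 1) * p = h + 1 + a * p + (p - 1) by
        rw [add_mul, one_mul]; have := hp.out.pos; omega,
      padicValNat_oddProd_const hph a (by have := hp.out.pos; omega), ih,
      padicValNat_oddProd_succ p (a + 1)]
    ring

/-- Bound for the valuation beyond the first multiple of `p`. -/
theorem padicValNat_oddProd_bound (a : ℕ) {t : ℕ} (ht : t < p) :
    (p - 1) * padicValNat p (oddProd (h + 1 + a * p + t)) ≤ (p - 1) * (a + 1) + 2 * a := by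
  rw [padicValNat_oddProd_const hph a ht, padicValNat_oddProd_add_mul hph, mul_add]
  exact Nat.add_le_add_left (sub_one_mul_padicValNat_oddProd_le p a) _

end DoubleFactorial

section Slopes

variable {p : ℕ} [hp : Fact p.Prime] {h : ℕ} (hph : p = 2 * h + 1) {s : ℝ}

theorem oddProd_slope_le_one (p : ℕ) [Fact p.Prime] {h : ℕ} (hph : p = 2 * h + 1) (a : ℕ) :
    (h : ℝ) * padicValNat p (oddProd (a + 1)) ≤ a := by
  have h1 := sub_one_mul_padicValNat_oddProd_le p a
  rw [show p - 1 = 2 * h by omega, mul_assoc] at h1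
  exact_mod_cast Nat.le_of_mul_le_mul_left h1 two_pos

include hph

theorem oddProd_slope_decomp {t : ℕ} (ht : h < t) :
    ∃ a t₀ : ℕ, t = h + 1 + a * p + t₀ ∧ t₀ < p ∧
      (h : ℝ) * (padicValNat p (oddProd t) - 1) ≤ a * (h + 1) := by
  refine ⟨(t - h - 1) / p, (t - h - 1) % p, ?_, Nat.mod_lt _ hp.out.pos, ?_⟩
  · have := Nat.div_add_mod' (t - h - 1) p
    omega
  · have h1 := padicValNat_oddProd_bound hph ((t - h - 1) / p)
      (t := (t - h - 1) % p) (Nat.mod_lt _ hp.out.pos)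
    have h2 : h + 1 + (t - h - 1) / p * p + (t - h - 1) % p = t := by
      have := Nat.div_add_mod' (t - h - 1) p
      omega
    rw [h2, show p - 1 = 2 * h by omega] at h1
    have h3 : (2 * h * padicValNat p (oddProd t) : ℝ) ≤
      2 * h * (((t - h - 1) / p : ℕ) + 1) + 2 * ((t - h - 1) / p : ℕ) := by exact_mod_cast h1
    linarith

variable (hh : 1 ≤ h) (hs : 1 ≤ s * (2 * h - 1))
include hh hs

theorem oddProd_slope_lt_sub_half {t : ℕ} (ht : h < t) :
    (padicValNat p (oddProd t) : ℝ) - 1 < (t - h - 1 / 2) * s := by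
  obtain ⟨a, t₀, ht, -, hb⟩ := oddProd_slope_decomp hph ht
  have hh' : (1 : ℝ) ≤ h := by exact_mod_cast hh
  have ht' : (t : ℝ) = h + 1 + a * (2 * h + 1) + t₀ := by
    rw [ht, hph]; push_cast; ring
  have ha : (0 : ℝ) ≤ a := Nat.cast_nonneg _
  have ht0 : (0 : ℝ) ≤ t₀ := Nat.cast_nonneg _
  set v := (padicValNat p (oddProd t) : ℝ) - 1
  have hk : 0 < (h : ℝ) * (2 * h - 1) := by nlinarith
  have h1 : (h : ℝ) * (2 * h - 1) * v ≤ (2 * h - 1) * (a * (h + 1)) := by nlinarith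
  have h2 : (h : ℝ) * (t - h - 1 / 2) * 1 ≤ h * (t - h - 1 / 2) * (s * (2 * h - 1)) := by
    refine mul_le_mul_of_nonneg_left hs ?_
    rw [ht']
    have : 0 ≤ (a : ℝ) * (2 * h + 1) := by positivity
    nlinarith
  refine lt_of_mul_lt_mul_left (a := (h : ℝ) * (2 * h - 1)) ?_ hk.le
  rw [ht'] at *
  nlinarith [mul_nonneg ha ht0, mul_nonneg (zero_le_one.trans hh') ht0]

theorem oddProd_succ_slope_lt_sub {t : ℕ} (ht : h < t) :
    (padicValNat p (oddProd (t + 1)) : ℝ) - 1 < (t - h) * s := by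
  obtain ⟨a, t₀, ht1, -, hb⟩ := oddProd_slope_decomp hph (t := t + 1) (by omega)
  have hh' : (1 : ℝ) ≤ h := by exact_mod_cast hh
  have ht' : (t : ℝ) = h + a * (2 * h + 1) + t₀ := by
    have : t = h + a * (2 * h + 1) + t₀ := by rw [← hph]; omega
    exact_mod_cast this
  have ha : (0 : ℝ) ≤ a := Nat.cast_nonneg _
  have ht0 : (0 : ℝ) ≤ t₀ := Nat.cast_nonneg _
  have hth : (h : ℝ) < t := by exact_mod_cast ht
  set v := (padicValNat p (oddProd (t + 1)) : ℝ) - 1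
  have hk : 0 < (h : ℝ) * (2 * h - 1) := by nlinarith
  have h1 : (h : ℝ) * (2 * h - 1) * v ≤ (2 * h - 1) * (a * (h + 1)) := by nlinarith
  have h2 : (h : ℝ) * (t - h) * 1 ≤ h * (t - h) * (s * (2 * h - 1)) :=
    mul_le_mul_of_nonneg_left hs (by nlinarith)
  refine lt_of_mul_lt_mul_left (a := (h : ℝ) * (2 * h - 1)) ?_ hk.le
  have h3 : (2 * h - 1) * (a * (h + 1)) < (h : ℝ) * (t - h) := by
    rw [ht'] at hth ⊢
    rcases ha.eq_or_lt with h0 | h0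
    · rw [← h0] at hth ⊢
      nlinarith
    · nlinarith [mul_nonneg (zero_le_one.trans hh') ht0]
  nlinarith

theorem oddProd_slope_lt_sub_half' {t : ℕ} (ht : 1 ≤ t) :
    (padicValNat p (oddProd t) : ℝ) - 1 < (t - 1 / 2) * s := by
  have hh' : (1 : ℝ) ≤ h := by exact_mod_cast hh
  have hs0 : 0 < s := by
    by_contra hc
    nlinarith
  rcases le_or_gt t h with hle | hlt
  · have : (1 : ℝ) ≤ t := by exact_mod_cast ht
    rw [padicValNat_oddProd_eq_zero hph hle]
    push_cast
    nlinarith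
  · have := oddProd_slope_lt_sub_half hph hh hs hlt
    nlinarith

theorem oddProd_slope_lt_of_dvd {t : ℕ} (ht : 1 ≤ t) (hd : p ∣ t) :
    (padicValNat p (oddProd t) : ℝ) < t * s := by
  obtain ⟨a, rfl⟩ := hd
  obtain ⟨b, rfl⟩ : ∃ b, a = b + 1 := ⟨a - 1, by
    have : a ≠ 0 := by rintro rfl; simp at ht
    omega⟩
  have hb := padicValNat_oddProd_bound hph b (t := h) (by omega)
  rw [show h + 1 + b * p + h = p * (b + 1) by rw [hph]; ring, show p - 1 = 2 * h by omega] at hb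
  have hb' : (2 * h * padicValNat p (oddProd (p * (b + 1))) : ℝ) ≤ 2 * h * (b + 1) + 2 * b := by
    exact_mod_cast hb
  have hh' : (1 : ℝ) ≤ h := by exact_mod_cast hh
  have hb0 : (0 : ℝ) ≤ b := Nat.cast_nonneg _
  set v := (padicValNat p (oddProd (p * (b + 1))) : ℝ)
  have hk : 0 < (h : ℝ) * (2 * h - 1) := by nlinarith
  have hp' : ((p * (b + 1) : ℕ) : ℝ) = (2 * h + 1) * (b + 1) := by rw [hph]; push_cast; ring
  rw [hp']
  have h1 : (h : ℝ) * (2 * h - 1) * v ≤ (2 * h - 1) * (h * (b + 1) + b) := by nlinarith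
  have h2 : (h : ℝ) * ((2 * h + 1) * (b + 1)) * 1 ≤ h * ((2 * h + 1) * (b + 1)) * (s * (2 * h - 1)) :=
    mul_le_mul_of_nonneg_left hs (by positivity)
  refine lt_of_mul_lt_mul_left (a := (h : ℝ) * (2 * h - 1)) ?_ hk.le
  nlinarith

end Slopes

section Dominance

variable {K : Type*} [NormedField K] [IsUltrametricDist K]

theorem norm_aeval_lt_of_forall_lt (f : ℤ[X]) (x : K) {B : ℝ}
    (hB : ∀ r, ‖(f.coeff r : K) * x ^ r‖ < B) : ‖aeval x f‖ < B := by
  rw [aeval_eq_sum_range]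
  simp only [zsmul_eq_mul]
  obtain ⟨r, -, hr⟩ := IsUltrametricDist.exists_norm_finsetSum_le (range (f.natDegree + 1))
    (fun r => (f.coeff r : K) * x ^ r)
  exact hr.trans_lt (hB r)

theorem norm_aeval_eq_of_dominant (f : ℤ[X]) (x : K) (r₀ : ℕ)
    (hB : ∀ r, r ≠ r₀ → ‖(f.coeff r : K) * x ^ r‖ < ‖(f.coeff r₀ : K) * x ^ r₀‖) :
    ‖aeval x f‖ = ‖(f.coeff r₀ : K) * x ^ r₀‖ := by
  have hpos : 0 < ‖(f.coeff r₀ : K) * x ^ r₀‖ :=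
    (norm_nonneg _).trans_lt (hB (r₀ + 1) (by omega))
  have h1 : ‖aeval x (f - monomial r₀ (f.coeff r₀))‖ < ‖(f.coeff r₀ : K) * x ^ r₀‖ := by
    refine norm_aeval_lt_of_forall_lt _ _ fun r => ?_
    rw [coeff_sub, coeff_monomial]
    split_ifs with h
    · subst h
      simpa using hpos
    · rw [sub_zero]
      exact hB r (Ne.symm h)
  rw [map_sub, aeval_monomial, eq_intCast] at h1
  have h2 := IsUltrametricDist.norm_add_eq_max_of_norm_ne_norm h1.ne
  rwa [sub_add_cancel, max_eq_right h1.le] at h2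

end Dominance

section HermiteValuations

theorem natAbs_coeff_hermite (i k : ℕ) :
    ((hermite (2 * i + k)).coeff k).natAbs = oddProd i * (2 * i + k).choose k := by
  rw [coeff_hermite_explicit, Int.natAbs_mul, Int.natAbs_mul, Int.natAbs_pow]
  simp [oddProd]

theorem padicValNat_oddProd_one (p : ℕ) : padicValNat p (oddProd 1) = 0 := by
  rw [show oddProd 1 = 1 from rfl, padicValNat_one_right]

variable (p : ℕ) [hp : Fact p.Prime]

theorem coeff_hermite_even_ne_zero {M t : ℕ} (ht : t ≤ M) :
    (hermite (2 * M)).coeff (2 * t) ≠ 0 := by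
  rw [← Int.natAbs_ne_zero]
  obtain ⟨i, rfl⟩ := Nat.exists_eq_add_of_le' ht
  rw [mul_add, natAbs_coeff_hermite]
  exact (Nat.mul_pos (oddProd_pos i) (Nat.choose_pos (by omega))).ne'

theorem coeff_hermite_odd_ne_zero {M t : ℕ} (ht : t ≤ M) :
    (hermite (2 * M + 1)).coeff (2 * t + 1) ≠ 0 := by
  rw [← Int.natAbs_ne_zero]
  obtain ⟨i, rfl⟩ := Nat.exists_eq_add_of_le' ht
  rw [mul_add, add_assoc, natAbs_coeff_hermite]
  exact (Nat.mul_pos (oddProd_pos i) (Nat.choose_pos (by omega))).ne'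

theorem padicValNat_coeff_hermite_even {M t : ℕ} (ht : t ≤ M) :
    padicValNat p ((hermite (2 * M)).coeff (2 * t)).natAbs + padicValNat p (oddProd t) =
      padicValNat p (oddProd M) + padicValNat p (M.choose t) := by
  have h0 := Int.natAbs_ne_zero.2 (coeff_hermite_even_ne_zero ht)
  obtain ⟨i, rfl⟩ := Nat.exists_eq_add_of_le' ht
  rw [← padicValNat.mul h0 (oddProd_pos t).ne',
    ← padicValNat.mul (oddProd_pos _).ne' (Nat.choose_pos ht).ne', ← oddProd_mul_choose_even,
    mul_add, natAbs_coeff_hermite]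

theorem padicValNat_coeff_hermite_odd {M t : ℕ} (ht : t ≤ M) :
    padicValNat p ((hermite (2 * M + 1)).coeff (2 * t + 1)).natAbs
        + padicValNat p (oddProd (t + 1)) =
      padicValNat p (oddProd (M + 1)) + padicValNat p (M.choose t) := by
  have h0 := Int.natAbs_ne_zero.2 (coeff_hermite_odd_ne_zero ht)
  obtain ⟨i, rfl⟩ := Nat.exists_eq_add_of_le' ht
  rw [← padicValNat.mul h0 (oddProd_pos _).ne',
    ← padicValNat.mul (oddProd_pos _).ne' (Nat.choose_pos ht).ne', ← oddProd_mul_choose_odd,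
    mul_add, add_assoc, natAbs_coeff_hermite]

theorem hermite_even_coeff_cases {M r : ℕ} (h : (hermite (2 * M)).coeff r ≠ 0) :
    ∃ t ≤ M, r = 2 * t := by
  have h1 : r ≤ 2 * M := by
    by_contra hlt
    exact h (coeff_hermite_of_lt (by omega))
  have h2 : ¬ Odd (2 * M + r) := fun ho => h (coeff_hermite_of_odd_add ho)
  rw [Nat.not_odd_iff_even, Nat.even_iff] at h2
  exact ⟨r / 2, by omega, by omega⟩

theorem hermite_odd_coeff_cases {M r : ℕ} (h : (hermite (2 * M + 1)).coeff r ≠ 0) :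
    ∃ t ≤ M, r = 2 * t + 1 := by
  have h1 : r ≤ 2 * M + 1 := by
    by_contra hlt
    exact h (coeff_hermite_of_lt (by omega))
  have h2 : ¬ Odd (2 * M + 1 + r) := fun ho => h (coeff_hermite_of_odd_add ho)
  rw [Nat.not_odd_iff_even, Nat.even_iff] at h2
  exact ⟨r / 2, by omega, by omega⟩

end HermiteValuations

section NormNe

variable {p : ℕ} [hp : Fact p.Prime] {h : ℕ} (hph : p = 2 * h + 1) {s : ℝ}
  {K : Type*} [NormedField K]
  (hK : ∀ a : ℕ, a ≠ 0 → ‖(a : K)‖ = (p : ℝ) ^ (-(padicValNat p a : ℝ)))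
  {x : K} (hx : ‖x‖ = (p : ℝ) ^ (-(s / 2)))

include hK hx

theorem norm_intCast_mul_pow {c : ℤ} (hc : c ≠ 0) (r : ℕ) :
    ‖(c : K) * x ^ r‖ = (p : ℝ) ^ (-(padicValNat p c.natAbs + r * (s / 2))) := by
  have hp0 : (0 : ℝ) < p := by exact_mod_cast hp.out.pos
  have h1 : ‖(c : K)‖ = ‖((c.natAbs : ℕ) : K)‖ := by
    rcases Int.natAbs_eq c with h | h
    · nth_rw 1 [h]; rw [Int.cast_natCast]
    · nth_rw 1 [h]; rw [Int.cast_neg, norm_neg, Int.cast_natCast]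
  rw [norm_mul, norm_pow, h1, hK _ (Int.natAbs_ne_zero.2 hc), hx, ← Real.rpow_natCast,
    ← Real.rpow_mul hp0.le, ← Real.rpow_add hp0]
  congr 1
  ring

theorem norm_term_lt {c d : ℤ} (hd : d ≠ 0) {r k : ℕ}
    (hlt : c ≠ 0 → (padicValNat p d.natAbs + k * (s / 2) : ℝ)
      < padicValNat p c.natAbs + r * (s / 2)) :
    ‖(c : K) * x ^ r‖ < ‖(d : K) * x ^ k‖ := by
  have hp1 : (1 : ℝ) < p := by exact_mod_cast hp.out.one_lt
  rw [norm_intCast_mul_pow hK hx hd]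
  rcases eq_or_ne c 0 with rfl | hc
  · rw [Int.cast_zero, zero_mul, norm_zero]
    positivity
  · rw [norm_intCast_mul_pow hK hx hc]
    exact Real.rpow_lt_rpow_of_exponent_lt hp1 (neg_lt_neg (hlt hc))

variable [IsUltrametricDist K]

include hph

theorem norm_derivative_hermite_even_lt (hh : 1 ≤ h) (hs : 1 ≤ s * (2 * h - 1)) {M : ℕ}
    (hM : p ∣ M) :
    ‖aeval x (derivative (hermite (2 * M)))‖ < ‖aeval x (hermite (2 * M))‖ := by
  have h0 : (hermite (2 * M)).coeff 0 ≠ 0 := coeff_hermite_even_ne_zero (Nat.zero_le M)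
  have hv0 : padicValNat p ((hermite (2 * M)).coeff 0).natAbs = padicValNat p (oddProd M) := by
    simpa [oddProd_zero] using padicValNat_coeff_hermite_even p (Nat.zero_le M)
  have hkey {t : ℕ} (ht : 1 ≤ t) (htM : t ≤ M) :
      1 ≤ padicValNat p t + padicValNat p (M.choose t) := by
    rw [← padicValNat.mul (by omega) (Nat.choose_pos htM).ne']
    refine one_le_padicValNat_of_dvd (Nat.mul_pos (by omega) (Nat.choose_pos htM)).ne' ?_
    obtain ⟨m, rfl⟩ : ∃ m, M = m + 1 := ⟨M - 1, by omega⟩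
    obtain ⟨u, rfl⟩ : ∃ u, t = u + 1 := ⟨t - 1, by omega⟩
    rw [mul_comm, ← Nat.add_one_mul_choose_eq]
    exact hM.mul_right _
  have hf := norm_aeval_eq_of_dominant (hermite (2 * M)) x 0 fun r hr => by
    refine norm_term_lt hK hx h0 fun hc => ?_
    obtain ⟨t, htM, rfl⟩ := hermite_even_coeff_cases hc
    have h1 := padicValNat_coeff_hermite_even p htM
    have ht : 1 ≤ t := by omega
    rw [hv0]
    have h1' : (padicValNat p ((hermite (2 * M)).coeff (2 * t)).natAbs
      + padicValNat p (oddProd t) : ℝ) = padicValNat p (oddProd M) + padicValNat p (M.choose t) := by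
      exact_mod_cast h1
    have hs0 : 0 < s := by
      have : (1 : ℝ) ≤ h := by exact_mod_cast hh
      by_contra hc
      nlinarith
    push_cast
    by_cases hd : p ∣ t
    · have h2 := oddProd_slope_lt_of_dvd hph hh hs ht hd
      have : (0 : ℝ) ≤ padicValNat p (M.choose t) := Nat.cast_nonneg _
      linarith
    · have h2 := oddProd_slope_lt_sub_half' hph hh hs ht
      have h3 := hkey ht htM
      rw [padicValNat.eq_zero_of_not_dvd hd] at h3
      have : (1 : ℝ) ≤ padicValNat p (M.choose t) := by exact_mod_cast (by omega)
      linarith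
  rw [hf]
  refine norm_aeval_lt_of_forall_lt _ _ fun r => norm_term_lt hK hx h0 fun hc => ?_
  rw [coeff_derivative] at hc ⊢
  obtain ⟨t, htM, hrt⟩ := hermite_even_coeff_cases (left_ne_zero_of_mul hc)
  have ht : 1 ≤ t := by omega
  have h1 := padicValNat_coeff_hermite_even p htM
  have h3 := hkey ht htM
  have hr1 : ((r : ℤ) + 1).natAbs = 2 * t := by omega
  have h2t : padicValNat p (2 * t) = padicValNat p t := by
    rw [padicValNat.mul two_ne_zero (by omega), padicValNat.eq_zero_of_not_dvd (n := 2), zero_add]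
    intro hd
    have := Nat.le_of_dvd two_pos hd
    omega
  have h2 := oddProd_slope_lt_sub_half' hph hh hs ht
  rw [Int.natAbs_mul, padicValNat.mul (Int.natAbs_ne_zero.2 (left_ne_zero_of_mul hc))
    (by omega), hr1, h2t, hv0, hrt]
  have h1' : (padicValNat p ((hermite (2 * M)).coeff (2 * t)).natAbs
    + padicValNat p (oddProd t) : ℝ) = padicValNat p (oddProd M) + padicValNat p (M.choose t) := by
    exact_mod_cast h1
  have h3' : (1 : ℝ) ≤ padicValNat p t + padicValNat p (M.choose t) := by exact_mod_cast h3
  have hr : (r : ℝ) = 2 * t - 1 := by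
    have : (r + 1 : ℝ) = 2 * t := by exact_mod_cast hrt
    linarith
  push_cast
  rw [hr]
  linarith

theorem norm_hermite_odd_lt_of_large_slope (hh : 1 ≤ h) (hs : 1 ≤ s * h) (M : ℕ) :
    ‖aeval x (hermite (2 * M + 1))‖ < ‖aeval x (derivative (hermite (2 * M + 1)))‖ := by
  have h0 : (hermite (2 * M + 1)).coeff 1 ≠ 0 := coeff_hermite_odd_ne_zero (Nat.zero_le M)
  have hv0 : padicValNat p ((hermite (2 * M + 1)).coeff 1).natAbs
      = padicValNat p (oddProd (M + 1)) := by
    have := padicValNat_coeff_hermite_odd p (Nat.zero_le M)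
    rwa [zero_add, padicValNat_oddProd_one, Nat.choose_zero_right, padicValNat_one_right] at this
  have hh' : (1 : ℝ) ≤ h := by exact_mod_cast hh
  have hs0 : 0 < s := by
    by_contra hc
    nlinarith
  have hd0 : (derivative (hermite (2 * M + 1))).coeff 0 = (hermite (2 * M + 1)).coeff 1 := by
    rw [coeff_derivative]
    simp
  have hf := norm_aeval_eq_of_dominant (derivative (hermite (2 * M + 1))) x 0 fun r hr => by
    rw [hd0]
    refine norm_term_lt hK hx h0 fun hc => ?_
    rw [coeff_derivative] at hc ⊢
    obtain ⟨t, htM, hrt⟩ := hermite_odd_coeff_cases (left_ne_zero_of_mul hc)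
    obtain ⟨t, rfl⟩ : ∃ u, t = u + 1 := ⟨t - 1, by omega⟩
    have h1 := padicValNat_coeff_hermite_odd p htM
    have h2 := padicValNat_oddProd_succ p (t + 1)
    have h3 := oddProd_slope_le_one p hph t
    have hr1 : ((r : ℤ) + 1).natAbs = 2 * (t + 1) + 1 := by omega
    rw [Int.natAbs_mul, padicValNat.mul (Int.natAbs_ne_zero.2 (left_ne_zero_of_mul hc))
      (by omega), hr1, hv0, hrt]
    have h1' : (padicValNat p ((hermite (2 * M + 1)).coeff (2 * (t + 1) + 1)).natAbs
        + (padicValNat p (oddProd (t + 1)) + padicValNat p (2 * (t + 1) + 1)) : ℝ) =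
        padicValNat p (oddProd (M + 1)) + padicValNat p (M.choose (t + 1)) := by
      rw [h2] at h1
      exact_mod_cast h1
    have h4 : (0 : ℝ) ≤ padicValNat p (M.choose (t + 1)) := Nat.cast_nonneg _
    have hr : (r : ℝ) = 2 * (t + 1) := by
      have : r = 2 * (t + 1) := by omega
      exact_mod_cast this
    have h5 : (padicValNat p (oddProd (t + 1)) : ℝ) ≤ t * s := by
      refine le_of_mul_le_mul_left (a := (h : ℝ)) ?_ (by linarith)
      have : (0 : ℝ) ≤ t := Nat.cast_nonneg _
      nlinarith
    push_cast at h1' ⊢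
    rw [hr]
    linarith
  rw [hf, hd0, pow_zero, ← pow_zero x]
  refine norm_aeval_lt_of_forall_lt _ _ fun r => norm_term_lt hK hx h0 fun hc => ?_
  obtain ⟨t, htM, rfl⟩ := hermite_odd_coeff_cases hc
  have h1 := padicValNat_coeff_hermite_odd p htM
  have h3 := oddProd_slope_le_one p hph t
  have h1' : (padicValNat p ((hermite (2 * M + 1)).coeff (2 * t + 1)).natAbs
      + padicValNat p (oddProd (t + 1)) : ℝ) =
      padicValNat p (oddProd (M + 1)) + padicValNat p (M.choose t) := by
    exact_mod_cast h1
  have h4 : (0 : ℝ) ≤ padicValNat p (M.choose t) := Nat.cast_nonneg _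
  have h5 : (padicValNat p (oddProd (t + 1)) : ℝ) ≤ t * s := by
    refine le_of_mul_le_mul_left (a := (h : ℝ)) ?_ (by linarith)
    have : (0 : ℝ) ≤ t := Nat.cast_nonneg _
    nlinarith
  rw [hv0]
  push_cast
  linarith

theorem norm_derivative_hermite_odd_lt_of_small_slope (hh : 1 ≤ h) (hs : 1 ≤ s * (2 * h - 1))
    (hs2 : s * (2 * h + 1) < 2) (m : ℕ) :
    ‖aeval x (derivative (hermite (2 * (h + m * p) + 1)))‖ <
      ‖aeval x (hermite (2 * (h + m * p) + 1))‖ := by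
  set M := h + m * p with hM
  have hhM : h ≤ M := by omega
  have h0 : (hermite (2 * M + 1)).coeff (2 * h + 1) ≠ 0 := coeff_hermite_odd_ne_zero hhM
  have hh' : (1 : ℝ) ≤ h := by exact_mod_cast hh
  have hs0 : 0 < s := by
    by_contra hc
    nlinarith
  have hch : padicValNat p (M.choose h) = 0 := by
    refine padicValNat.eq_zero_of_not_dvd fun hd => ?_
    have h1 := Choose.choose_modEq_choose_mod_mul_choose_div_nat (n := M) (k := h) (p := p)
    have hlt : h < p := by omega
    rw [hM, Nat.add_mul_mod_self_right, Nat.mod_eq_of_lt hlt, Nat.choose_self,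
      Nat.div_eq_of_lt hlt, Nat.choose_zero_right, mul_one, ← hM] at h1
    have := (Nat.modEq_zero_iff_dvd.2 hd).symm.trans h1
    rw [Nat.ModEq, Nat.zero_mod, Nat.mod_eq_of_lt hp.out.one_lt] at this
    omega
  have hv0 : (padicValNat p ((hermite (2 * M + 1)).coeff (2 * h + 1)).natAbs : ℝ) + 1
      = padicValNat p (oddProd (M + 1)) := by
    have h1 := padicValNat_coeff_hermite_odd p hhM
    have h2 := padicValNat_oddProd_add_mul hph 0
    rw [zero_add, zero_mul, add_zero, padicValNat_oddProd_one, add_zero] at h2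
    rw [h2, hch] at h1
    exact_mod_cast h1
  have hf := norm_aeval_eq_of_dominant (hermite (2 * M + 1)) x (2 * h + 1) fun r hr => by
    refine norm_term_lt hK hx h0 fun hc => ?_
    obtain ⟨t, htM, rfl⟩ := hermite_odd_coeff_cases hc
    have h1 := padicValNat_coeff_hermite_odd p htM
    have h1' : (padicValNat p ((hermite (2 * M + 1)).coeff (2 * t + 1)).natAbs
        + padicValNat p (oddProd (t + 1)) : ℝ) =
        padicValNat p (oddProd (M + 1)) + padicValNat p (M.choose t) := by
      exact_mod_cast h1
    have h4 : (0 : ℝ) ≤ padicValNat p (M.choose t) := Nat.cast_nonneg _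
    push_cast
    rcases lt_or_gt_of_ne (show t ≠ h by omega) with hlt | hgt
    · rw [padicValNat_oddProd_eq_zero hph (by omega)] at h1'
      have : (0 : ℝ) ≤ t := Nat.cast_nonneg _
      push_cast at h1'
      nlinarith
    · have := oddProd_succ_slope_lt_sub hph hh hs hgt
      linarith
  rw [hf]
  refine norm_aeval_lt_of_forall_lt _ _ fun r => norm_term_lt hK hx h0 fun hc => ?_
  rw [coeff_derivative] at hc ⊢
  obtain ⟨t, htM, hrt⟩ := hermite_odd_coeff_cases (left_ne_zero_of_mul hc)
  have h1 := padicValNat_coeff_hermite_odd p htM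
  have h2 := padicValNat_oddProd_succ p t
  have hr1 : ((r : ℤ) + 1).natAbs = 2 * t + 1 := by omega
  rw [Int.natAbs_mul, padicValNat.mul (Int.natAbs_ne_zero.2 (left_ne_zero_of_mul hc))
    (by omega), hr1, hrt]
  have h1' : (padicValNat p ((hermite (2 * M + 1)).coeff (2 * t + 1)).natAbs
      + (padicValNat p (oddProd t) + padicValNat p (2 * t + 1)) : ℝ) =
      padicValNat p (oddProd (M + 1)) + padicValNat p (M.choose t) := by
    rw [h2] at h1
    exact_mod_cast h1
  have h4 : (0 : ℝ) ≤ padicValNat p (M.choose t) := Nat.cast_nonneg _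
  have hr : (r : ℝ) = 2 * t := by
    have : r = 2 * t := by omega
    exact_mod_cast this
  push_cast at h1' ⊢
  rw [hr]
  rcases le_or_gt t h with hle | hgt
  · rw [padicValNat_oddProd_eq_zero hph hle] at h1'
    have : (0 : ℝ) ≤ t := Nat.cast_nonneg _
    push_cast at h1'
    nlinarith
  · have := oddProd_slope_lt_sub_half hph hh hs hgt
    linarith

theorem norm_hermite_ne_norm_derivative (hh : 1 ≤ h) (hs : 1 ≤ s * (2 * h - 1))
    (hs2 : s * (2 * h + 1) < 2 ∨ 1 ≤ s * h) (q : ℕ) :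
    ‖aeval x (hermite (q * p))‖ ≠ ‖aeval x (derivative (hermite (q * p)))‖ := by
  rcases Nat.even_or_odd q with ⟨m, rfl⟩ | ⟨m, rfl⟩
  · rw [show (m + m) * p = 2 * (m * p) by ring]
    exact (norm_derivative_hermite_even_lt hph hK hx hh hs (dvd_mul_left _ _)).ne'
  · rw [show (2 * m + 1) * p = 2 * (h + m * p) + 1 by rw [hph]; ring]
    rcases hs2 with hs2 | hs2
    · exact (norm_derivative_hermite_odd_lt_of_small_slope hph hK hx hh hs hs2 m).ne'
    · exact (norm_hermite_odd_lt_of_large_slope hph hK hx hh hs2 _).ne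

end NormNe

section NormPropagation

variable {K : Type*} [NormedField K] [IsUltrametricDist K] {x : K}

theorem norm_sub_le_max_norm (a b : K) : ‖a - b‖ ≤ max ‖a‖ ‖b‖ := by
  rw [sub_eq_add_neg, ← norm_neg b]
  exact IsUltrametricDist.norm_add_le_max a (-b)

theorem norm_hermite_ne_succ (hx : ‖x‖ < 1) {n : ℕ} (hn : ‖((n : K) + 1)‖ = 1)
    (hne : ‖aeval x (hermite n)‖ ≠ ‖aeval x (derivative (hermite n))‖) :
    ‖aeval x (hermite (n + 1))‖ ≠ ‖aeval x (derivative (hermite (n + 1)))‖ := by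
  have h2 : ‖aeval x (derivative (hermite (n + 1)))‖ = ‖aeval x (hermite n)‖ := by
    rw [hermite_derivative_succ, map_mul, aeval_C, norm_mul]
    simp [hn]
  rw [h2, hermite_succ, map_sub, map_mul, aeval_X]
  set a := aeval x (hermite n)
  set b := aeval x (derivative (hermite n))
  have hxa : ‖x * a‖ = ‖x‖ * ‖a‖ := norm_mul _ _
  have ha := norm_nonneg a
  have hb := norm_nonneg b
  rcases lt_or_gt_of_ne hne with hlt | hgt
  · have h3 : ‖x * a‖ < ‖b‖ := by nlinarith
    have h4 : ‖x * a - b‖ = ‖b‖ := by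
      have := IsUltrametricDist.norm_add_eq_max_of_norm_ne_norm (x := x * a) (y := -b)
        (by rw [norm_neg]; exact h3.ne)
      rwa [norm_neg, max_eq_right h3.le, ← sub_eq_add_neg] at this
    rw [h4]
    exact hlt.ne'
  · refine (lt_of_le_of_lt (norm_sub_le_max_norm _ _) (max_lt ?_ hgt)).ne
    nlinarith

theorem aeval_diagWronskian_ne_zero_of_norm_ne (hx : ‖x‖ < 1) {n : ℕ}
    (hn : ‖((n : K) + 1)‖ = 1)
    (hne : ‖aeval x (hermite n)‖ ≠ ‖aeval x (derivative (hermite n))‖) :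
    aeval x (diagWronskian n) ≠ 0 := by
  intro h0
  have h1 : aeval x (diagWronskian n) = ((n : K) + 1) * aeval x (hermite n) ^ 2
      - x * aeval x (hermite n) * aeval x (derivative (hermite n))
      + aeval x (derivative (hermite n)) ^ 2 := by
    simp [diagWronskian]
  rw [h1] at h0
  set a := aeval x (hermite n)
  set b := aeval x (derivative (hermite n))
  have ha := norm_nonneg a
  have hb := norm_nonneg b
  have hA : ‖((n : K) + 1) * a ^ 2‖ = ‖a‖ ^ 2 := by rw [norm_mul, hn, one_mul, norm_pow]
  have hB : ‖b ^ 2‖ = ‖b‖ ^ 2 := norm_pow _ _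
  have hC : ‖x * a * b‖ ≤ ‖a‖ * ‖b‖ := by
    rw [norm_mul, norm_mul, mul_assoc]
    exact mul_le_of_le_one_left (by positivity) hx.le
  rcases lt_or_gt_of_ne hne with hlt | hgt
  · have h2 : b ^ 2 = x * a * b - ((n : K) + 1) * a ^ 2 := by linear_combination h0
    have h3 := norm_sub_le_max_norm (x * a * b) (((n : K) + 1) * a ^ 2)
    rw [← h2, hA, hB] at h3
    rcases le_max_iff.1 h3 with h | h <;> nlinarith
  · have h2 : ((n : K) + 1) * a ^ 2 = x * a * b - b ^ 2 := by linear_combination h0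
    have h3 := norm_sub_le_max_norm (x * a * b) (b ^ 2)
    rw [← h2, hA, hB] at h3
    rcases le_max_iff.1 h3 with h | h <;> nlinarith

end NormPropagation

section PadicRoots

variable {p : ℕ} [hp : Fact p.Prime]

theorem PadicAlgCl.norm_natCast_eq (a : ℕ) (ha : a ≠ 0) :
    ‖(a : PadicAlgCl p)‖ = (p : ℝ) ^ (-(padicValNat p a : ℝ)) := by
  have h := PadicAlgCl.norm_extends p (a : ℚ_[p])
  rw [map_natCast] at h
  rw [h, Padic.norm_eq_zpow_neg_valuation (by exact_mod_cast ha), Padic.valuation_natCast,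
    ← Real.rpow_intCast, Int.cast_neg, Int.cast_natCast]

/-- A monic integer polynomial with constant term divisible by `p` has a root of positive slope,
whose denominator is bounded by the degree. -/
theorem exists_root_norm_eq_rpow {g : ℤ[X]} (hg : g.Monic) (h0 : g.coeff 0 ≠ 0)
    (hpg : (p : ℤ) ∣ g.coeff 0) :
    ∃ θ : PadicAlgCl p, aeval θ g = 0 ∧ ∃ m b : ℕ, 1 ≤ m ∧ 1 ≤ b ∧ b ≤ g.natDegree ∧
      ‖θ‖ = (p : ℝ) ^ (-((m : ℝ) / b)) := by
  set G := g.map (algebraMap ℤ (PadicAlgCl p)) with hG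
  have hGm : G.Monic := hg.map _
  have hprod := (IsAlgClosed.splits G).coeff_zero_eq_prod_roots_of_monic hGm
  obtain ⟨θ, hθ, hθ1⟩ : ∃ θ ∈ G.roots, ‖θ‖ < 1 := by
    by_contra! hcon
    have h1 : ∀ s : Multiset (PadicAlgCl p), (∀ θ ∈ s, 1 ≤ ‖θ‖) → 1 ≤ ‖s.prod‖ := by
      intro s
      induction s using Multiset.induction with
      | empty => simp
      | cons a s ih =>
        intro h
        rw [Multiset.prod_cons, norm_mul]
        exact one_le_mul_of_one_le_of_one_le (h a (Multiset.mem_cons_self _ _))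
          (ih fun θ hθ => h θ (Multiset.mem_cons_of_mem hθ))
    have h2 := h1 _ hcon
    have h3 : ‖G.coeff 0‖ < 1 := by
      have h4 := (Padic.norm_intCast_lt_one_iff (p := p)).2 hpg
      have h5 := PadicAlgCl.norm_extends p (g.coeff 0 : ℚ_[p])
      rw [map_intCast] at h5
      rw [hG, coeff_map, eq_intCast, h5]
      exact h4
    rw [hprod, norm_mul, norm_pow, norm_neg, norm_one, one_pow, one_mul] at h3
    exact absurd h3 h2.not_gt
  have hroot : aeval θ g = 0 := by
    have := isRoot_of_mem_roots hθ
    rwa [IsRoot.def, hG, eval_map_algebraMap] at this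
  refine ⟨θ, hroot, ?_⟩
  have hθ0 : θ ≠ 0 := by
    rintro rfl
    rw [← coeff_zero_eq_aeval_zero'] at hroot
    exact h0 (by simpa using hroot)
  have hint : IsIntegral ℚ_[p] θ := Algebra.IsIntegral.isIntegral θ
  set φ := minpoly ℚ_[p] θ with hφ
  have hφd : φ ∣ g.map (algebraMap ℤ ℚ_[p]) := by
    apply minpoly.dvd
    rwa [aeval_map_algebraMap]
  have hdeg : φ.natDegree ≤ g.natDegree := by
    have := natDegree_le_of_dvd hφd (hg.map _).ne_zero
    rwa [hg.natDegree_map] at this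
  have hb1 : 1 ≤ φ.natDegree := minpoly.natDegree_pos hint
  have hc0 : φ.coeff 0 ≠ 0 := minpoly.coeff_zero_ne_zero hint hθ0
  have hnorm : ‖θ‖ = ‖φ.coeff 0‖ ^ (1 / φ.natDegree : ℝ) := by
    rw [← PadicAlgCl.spectralNorm_eq]
    exact spectralNorm.spectralNorm_eq_norm_coeff_zero_rpow ℚ_[p] _ θ
  have hp1 : (1 : ℝ) < p := by exact_mod_cast hp.out.one_lt
  have hb0 : (0 : ℝ) < φ.natDegree := by exact_mod_cast hb1
  rw [Padic.norm_eq_zpow_neg_valuation hc0, ← Real.rpow_intCast,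
    ← Real.rpow_mul (by linarith)] at hnorm
  have hval : 0 < (φ.coeff 0).valuation := by
    by_contra! hle
    have : (1 : ℝ) ≤ ‖θ‖ := by
      rw [hnorm]
      refine Real.one_le_rpow hp1.le (mul_nonneg ?_ (by positivity))
      exact_mod_cast neg_nonneg.2 hle
    linarith
  obtain ⟨m, hm⟩ := Int.eq_ofNat_of_zero_le hval.le
  rw [hm] at hnorm hval
  refine ⟨m, φ.natDegree, by exact_mod_cast hval, hb1, hdeg, ?_⟩
  rw [hnorm]
  congr 1
  push_cast
  ring

theorem not_dvd_coeff_zero_of_dvd_diagContract {h : ℕ} (hph : p = 2 * h + 1) {q u : ℕ}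
    (hu : u + 2 ≤ p) {g : ℤ[X]} (hg : g.Monic) (hd : g ∣ diagContract (q * p + u))
    (hdeg : g.natDegree + 2 ≤ p) (h0 : g.coeff 0 ≠ 0) : ¬ (p : ℤ) ∣ g.coeff 0 := by
  intro hpg
  obtain ⟨θ, hθ, m, b, hm, hb, hbg, hnorm⟩ := exists_root_norm_eq_rpow hg h0 hpg
  obtain ⟨x, hx⟩ := IsAlgClosed.exists_pow_nat_eq θ two_pos
  have hp1 : (1 : ℝ) < p := by exact_mod_cast hp.out.one_lt
  have hh : 1 ≤ h := by have := hp.out.two_le; omega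
  have hb0 : (0 : ℝ) < b := by exact_mod_cast hb
  have hxn : ‖x‖ = (p : ℝ) ^ (-((m / b : ℝ) / 2)) := by
    have h1 : ‖x‖ ^ 2 = ((p : ℝ) ^ (-((m / b : ℝ) / 2))) ^ 2 := by
      rw [← norm_pow, hx, hnorm, ← Real.rpow_natCast, ← Real.rpow_mul (by linarith)]
      congr 1
      push_cast
      ring
    exact (pow_left_inj₀ (norm_nonneg _) (by positivity) two_ne_zero).1 h1
  have hx1 : ‖x‖ < 1 := by
    rw [hxn]
    refine Real.rpow_lt_one_of_one_lt_of_neg hp1 ?_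
    have : (0 : ℝ) < m := by exact_mod_cast hm
    have : (0 : ℝ) < m / b := by positivity
    linarith
  have hW : aeval x (diagWronskian (q * p + u)) = 0 := by
    rw [← expand_diagContract, expand_aeval, hx]
    obtain ⟨f, hf⟩ := hd
    rw [hf, map_mul, hθ, zero_mul]
  have hs : 1 ≤ (m / b : ℝ) * (2 * h - 1) := by
    rw [div_mul_eq_mul_div, le_div_iff₀ hb0, one_mul]
    have h1 : (b : ℝ) + 1 ≤ 2 * h := by exact_mod_cast (by omega : b + 1 ≤ 2 * h)
    have h2 : (1 : ℝ) ≤ m := by exact_mod_cast hm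
    nlinarith
  have hs2 : (m / b : ℝ) * (2 * h + 1) < 2 ∨ 1 ≤ (m / b : ℝ) * h := by
    rw [div_mul_eq_mul_div, div_mul_eq_mul_div, div_lt_iff₀ hb0, le_div_iff₀ hb0, one_mul]
    have hne : m * (2 * h + 1) ≠ 2 * b := by
      rw [← hph]
      intro he
      have h1 : p ∣ 2 * b := Dvd.intro_left m he
      rcases hp.out.dvd_mul.1 h1 with h2 | h2
      · have := Nat.le_of_dvd two_pos h2
        omega
      · have := Nat.le_of_dvd hb h2
        omega
    rcases lt_or_gt_of_ne hne with hlt | hgt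
    · left; exact_mod_cast hlt
    · right
      have : b ≤ m * h := by
        rcases hm.eq_or_lt with h1 | h1
        · subst h1
          omega
        · nlinarith
      exact_mod_cast this
  have hunit {v : ℕ} (hv : v + 1 < p) : ‖((q * p + v : ℕ) : PadicAlgCl p) + 1‖ = 1 := by
    have h1 := PadicAlgCl.norm_natCast_eq (p := p) (q * p + v + 1) (by omega)
    have h2 : ¬ p ∣ q * p + v + 1 := by
      rw [add_assoc, Nat.dvd_add_right (dvd_mul_left _ _)]
      exact Nat.not_dvd_of_pos_of_lt (by omega) hv
    rw [padicValNat.eq_zero_of_not_dvd h2] at h1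
    simpa using h1
  have hind (v : ℕ) (hv : v < p) : ‖aeval x (hermite (q * p + v))‖ ≠
      ‖aeval x (derivative (hermite (q * p + v)))‖ := by
    induction v with
    | zero => exact norm_hermite_ne_norm_derivative hph PadicAlgCl.norm_natCast_eq hxn hh hs hs2 q
    | succ v ih => exact norm_hermite_ne_succ hx1 (hunit hv) (ih (by omega))
  exact aeval_diagWronskian_ne_zero_of_norm_ne hx1 (hunit (by omega)) (hind u (by omega)) hW

end PadicRoots

lemma exists_prime_of_three_primes {n k j : ℕ} (hk : n + 1 = k ^ 2) (hj : 1 ≤ j)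
    (hjn : 2 * j ≤ n) (p q i r l : ℕ)
    (h : p.Prime ∧ q.Prime ∧ r.Prime ∧ p ∣ k ^ 2 - 1 ∧ q ∣ k ^ 2 - 1 - i ∧ r ∣ k ^ 2 - 1 - l ∧
      i + 2 ≤ p ∧ l + 2 ≤ q ∧ (k ^ 2 - 1) / 2 + 2 ≤ r) :
    ∃ p i : ℕ, p.Prime ∧ j + 2 ≤ p ∧ i < j ∧ p ∣ n - i := by
  obtain ⟨hp, hq, hr, hpn, hqn, hrn, hip, hlq, hr2⟩ := h
  obtain rfl : n = k ^ 2 - 1 := by omega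
  rcases le_or_gt (j + 2) p with h | h
  · exact ⟨p, 0, hp, h, hj, hpn⟩
  rcases le_or_gt (j + 2) q with h' | h'
  · exact ⟨q, i, hq, h', by omega, hqn⟩
  · exact ⟨r, l, hr, by omega, by omega, hrn⟩

lemma exists_prime_of_two_primes {n k j : ℕ} (hk : n + 1 = k ^ 2) (hj : 1 ≤ j)
    (hjn : 2 * j ≤ n) (p q i : ℕ)
    (h : p.Prime ∧ q.Prime ∧ p ∣ k ^ 2 - 1 ∧ q ∣ k ^ 2 - 1 - i ∧ i + 2 ≤ p ∧
      (k ^ 2 - 1) / 2 + 2 ≤ q) :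
    ∃ p i : ℕ, p.Prime ∧ j + 2 ≤ p ∧ i < j ∧ p ∣ n - i := by
  obtain ⟨hp, hq, hpn, hqn, hip, hq2⟩ := h
  obtain rfl : n = k ^ 2 - 1 := by omega
  rcases le_or_gt (j + 2) p with h | h
  · exact ⟨p, 0, hp, h, hj, hpn⟩
  · exact ⟨q, i, hq, by omega, by omega, hqn⟩

lemma exists_prime_dvd_sub_of_lt {n k j : ℕ} (hk : n + 1 = k ^ 2) (hj : 1 ≤ j)
    (hjn : 2 * j ≤ n) (h8 : ¬ (n = 8 ∧ j = 1)) (hk64 : k < 64) :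
    ∃ p i : ℕ, p.Prime ∧ j + 2 ≤ p ∧ i < j ∧ p ∣ n - i := by
  interval_cases k
  · omega
  · omega
  · exact ⟨3, 0, by norm_num, by omega, hj, by obtain rfl : n = 3 := (by omega); norm_num⟩
  · exact ⟨7, 1, by norm_num, by omega, by omega, by obtain rfl : n = 8 := (by omega); norm_num⟩
  · exact exists_prime_of_two_primes hk hj hjn 5 13 2 (by norm_num)
  · exact exists_prime_of_two_primes hk hj hjn 3 23 1 (by norm_num)
  · exact exists_prime_of_two_primes hk hj hjn 7 31 4 (by norm_num)
  · exact exists_prime_of_two_primes hk hj hjn 3 47 1 (by norm_num)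
  · exact exists_prime_of_two_primes hk hj hjn 7 61 2 (by norm_num)
  · exact exists_prime_of_two_primes hk hj hjn 5 79 1 (by norm_num)
  · exact exists_prime_of_two_primes hk hj hjn 11 97 2 (by norm_num)
  · exact exists_prime_of_three_primes hk hj hjn 5 59 2 113 7 (by norm_num)
  · exact exists_prime_of_two_primes hk hj hjn 13 139 4 (by norm_num)
  · exact exists_prime_of_two_primes hk hj hjn 7 167 1 (by norm_num)
  · exact exists_prime_of_two_primes hk hj hjn 13 193 2 (by norm_num)
  · exact exists_prime_of_two_primes hk hj hjn 7 223 1 (by norm_num)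
  · exact exists_prime_of_two_primes hk hj hjn 17 251 4 (by norm_num)
  · exact exists_prime_of_three_primes hk hj hjn 3 41 1 283 5 (by norm_num)
  · exact exists_prime_of_two_primes hk hj hjn 19 317 6 (by norm_num)
  · exact exists_prime_of_two_primes hk hj hjn 5 359 1 (by norm_num)
  · exact exists_prime_of_two_primes hk hj hjn 19 397 2 (by norm_num)
  · exact exists_prime_of_two_primes hk hj hjn 11 439 1 (by norm_num)
  · exact exists_prime_of_two_primes hk hj hjn 23 479 4 (by norm_num)
  · exact exists_prime_of_two_primes hk hj hjn 11 523 5 (by norm_num)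
  · exact exists_prime_of_two_primes hk hj hjn 23 571 4 (by norm_num)
  · exact exists_prime_of_two_primes hk hj hjn 13 619 5 (by norm_num)
  · exact exists_prime_of_two_primes hk hj hjn 5 673 2 (by norm_num)
  · exact exists_prime_of_two_primes hk hj hjn 13 727 1 (by norm_num)
  · exact exists_prime_of_two_primes hk hj hjn 29 773 10 (by norm_num)
  · exact exists_prime_of_two_primes hk hj hjn 7 839 1 (by norm_num)
  · exact exists_prime_of_two_primes hk hj hjn 31 887 12 (by norm_num)
  · exact exists_prime_of_three_primes hk hj hjn 5 479 2 953 7 (by norm_num)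
  · exact exists_prime_of_two_primes hk hj hjn 31 1021 2 (by norm_num)
  · exact exists_prime_of_two_primes hk hj hjn 17 1087 1 (by norm_num)
  · exact exists_prime_of_two_primes hk hj hjn 11 1153 2 (by norm_num)
  · exact exists_prime_of_two_primes hk hj hjn 17 1223 1 (by norm_num)
  · exact exists_prime_of_two_primes hk hj hjn 37 1291 4 (by norm_num)
  · exact exists_prime_of_two_primes hk hj hjn 19 1367 1 (by norm_num)
  · exact exists_prime_of_two_primes hk hj hjn 37 1439 4 (by norm_num)
  · exact exists_prime_of_two_primes hk hj hjn 19 1511 9 (by norm_num)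
  · exact exists_prime_of_two_primes hk hj hjn 41 1597 2 (by norm_num)
  · exact exists_prime_of_three_primes hk hj hjn 7 839 2 1669 11 (by norm_num)
  · exact exists_prime_of_two_primes hk hj hjn 43 1759 4 (by norm_num)
  · exact exists_prime_of_two_primes hk hj hjn 11 1847 1 (by norm_num)
  · exact exists_prime_of_two_primes hk hj hjn 43 1933 2 (by norm_num)
  · exact exists_prime_of_two_primes hk hj hjn 23 2017 7 (by norm_num)
  · exact exists_prime_of_two_primes hk hj hjn 47 2113 2 (by norm_num)
  · exact exists_prime_of_two_primes hk hj hjn 23 2207 1 (by norm_num)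
  · exact exists_prime_of_two_primes hk hj hjn 47 2297 6 (by norm_num)
  · exact exists_prime_of_two_primes hk hj hjn 5 2399 1 (by norm_num)
  · exact exists_prime_of_three_primes hk hj hjn 17 1249 1 2477 22 (by norm_num)
  · exact exists_prime_of_two_primes hk hj hjn 13 2593 7 (by norm_num)
  · exact exists_prime_of_two_primes hk hj hjn 53 2699 4 (by norm_num)
  · exact exists_prime_of_two_primes hk hj hjn 13 2803 5 (by norm_num)
  · exact exists_prime_of_two_primes hk hj hjn 53 2909 6 (by norm_num)
  · exact exists_prime_of_two_primes hk hj hjn 7 3023 1 (by norm_num)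
  · exact exists_prime_of_two_primes hk hj hjn 19 3121 14 (by norm_num)
  · exact exists_prime_of_two_primes hk hj hjn 29 3229 19 (by norm_num)
  · exact exists_prime_of_two_primes hk hj hjn 59 3361 2 (by norm_num)
  · exact exists_prime_of_two_primes hk hj hjn 29 3469 11 (by norm_num)
  · exact exists_prime_of_two_primes hk hj hjn 61 3593 6 (by norm_num)
  · exact exists_prime_of_two_primes hk hj hjn 31 3719 1 (by norm_num)
  · exact exists_prime_of_two_primes hk hj hjn 61 3833 10 (by norm_num)
  · exact exists_prime_of_two_primes hk hj hjn 31 3967 1 (by norm_num)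

lemma exists_prime_of_forall_not_dvd {n j i m : ℕ} (hij : i < j) (hm : 1 < m) (hmn : m ∣ n - i)
    (h : ∀ p : ℕ, p.Prime → p ≤ j + 1 → ¬ p ∣ m) :
    ∃ p i : ℕ, p.Prime ∧ j + 2 ≤ p ∧ i < j ∧ p ∣ n - i := by
  obtain ⟨p, hp, hpm⟩ := Nat.exists_prime_and_dvd hm.ne'
  refine ⟨p, i, hp, ?_, hij, hpm.trans hmn⟩
  by_contra hlt
  exact h p hp (by omega) hpm

lemma exists_prime_dvd_sub_one {n k : ℕ} (hk : n + 1 = k ^ 2) (hk4 : 4 ≤ k) :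
    ∃ p i : ℕ, p.Prime ∧ 1 + 2 ≤ p ∧ i < 1 ∧ p ∣ n - i := by
  have key : ∃ m, 1 < m ∧ m ∣ n ∧ ¬ 2 ∣ m := by
    rcases Nat.even_or_odd' k with ⟨a, rfl | rfl⟩
    · refine ⟨2 * a - 1, by omega, ⟨2 * a + 1, ?_⟩, by omega⟩
      obtain ⟨b, rfl⟩ : ∃ b, a = b + 1 := ⟨a - 1, by omega⟩
      rw [show 2 * (b + 1) - 1 = 2 * b + 1 by omega]
      linarith
    · rcases Nat.even_or_odd' a with ⟨b, rfl | rfl⟩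
      · exact ⟨2 * b + 1, by omega, ⟨8 * b, by linarith⟩, by omega⟩
      · exact ⟨2 * b + 1, by omega, ⟨8 * b + 8, by linarith⟩, by omega⟩
  obtain ⟨m, hm, hmn, h2⟩ := key
  refine exists_prime_of_forall_not_dvd one_pos hm hmn fun p hp hp2 ↦ ?_
  obtain rfl : p = 2 := le_antisymm hp2 hp.two_le
  exact h2

lemma exists_prime_dvd_sub_two {n k : ℕ} (hk : n + 1 = k ^ 2) (hk4 : 4 ≤ k) :
    ∃ p i : ℕ, p.Prime ∧ 2 + 2 ≤ p ∧ i < 2 ∧ p ∣ n - i := by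
  have hn : 15 ≤ n := by nlinarith
  have h3 : ¬ 3 ∣ n - 1 := by
    have : k ^ 2 % 3 = 0 ∨ k ^ 2 % 3 = 1 := by
      have : k % 3 = 0 ∨ k % 3 = 1 ∨ k % 3 = 2 := by omega
      rcases this with h | h | h <;> simp [Nat.pow_mod, h]
    omega
  have h4 : ¬ 4 ∣ n - 1 := by
    have : k ^ 2 % 4 = 0 ∨ k ^ 2 % 4 = 1 := by
      have : k % 4 = 0 ∨ k % 4 = 1 ∨ k % 4 = 2 ∨ k % 4 = 3 := by omega
      rcases this with h | h | h | h <;> simp [Nat.pow_mod, h]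
    omega
  have key : ∃ m, 1 < m ∧ m ∣ n - 1 ∧ ¬ 2 ∣ m := by
    rcases Nat.even_or_odd' (n - 1) with ⟨a, ha | ha⟩
    · exact ⟨a, by omega, ⟨2, by omega⟩, by omega⟩
    · exact ⟨n - 1, by omega, dvd_rfl, by omega⟩
  obtain ⟨m, hm, hmn, h2⟩ := key
  refine exists_prime_of_forall_not_dvd one_lt_two hm hmn fun p hp hp3 hpm ↦ ?_
  have := hp.two_le
  interval_cases p
  · exact h2 hpm
  · exact h3 (hpm.trans hmn)

lemma choose_mul_pow_le {m n j : ℕ} (hmn : m ≤ n) :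
    m.choose j * n ^ j ≤ n.choose j * m ^ j := by
  have h : m.descFactorial j * n ^ j ≤ n.descFactorial j * m ^ j := by
    rw [Nat.descFactorial_eq_prod_range, Nat.descFactorial_eq_prod_range,
      ← card_range j, ← prod_const n, ← prod_const m, card_range, ← prod_mul_distrib,
      ← prod_mul_distrib]
    refine prod_le_prod' fun i hi ↦ ?_
    have := mem_range.1 hi
    rw [Nat.sub_mul, Nat.sub_mul, mul_comm m n]
    exact Nat.sub_le_sub_left (Nat.mul_le_mul_left i hmn) _
  rw [Nat.descFactorial_eq_factorial_mul_choose, Nat.descFactorial_eq_factorial_mul_choose,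
    mul_assoc, mul_assoc] at h
  exact Nat.le_of_mul_le_mul_left h (Nat.factorial_pos j)

lemma pow_le_pow_mul_choose {n j : ℕ} (hjn : j ≤ n) : n ^ j ≤ n.choose j * j ^ j := by
  simpa using choose_mul_pow_le (j := j) hjn

lemma two_mul_pow_le {n j : ℕ} (hj : 1 ≤ j) (hjn : 2 * j ≤ n) :
    (2 * n) ^ j ≤ 2 * j * n.choose j * j ^ j := by
  have h1 := choose_mul_pow_le (j := j) hjn
  have h2 := Nat.four_pow_le_two_mul_self_mul_centralBinom j hj
  rw [Nat.centralBinom] at h2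
  have h3 : 2 ^ j * (2 * n) ^ j ≤ 2 ^ j * (2 * j * n.choose j * j ^ j) := by
    calc 2 ^ j * (2 * n) ^ j = 4 ^ j * n ^ j := by
          rw [← mul_pow, ← mul_pow]; ring_nf
      _ ≤ 2 * j * (2 * j).choose j * n ^ j := Nat.mul_le_mul_right _ h2
      _ = 2 * j * ((2 * j).choose j * n ^ j) := by ring
      _ ≤ 2 * j * (n.choose j * (2 * j) ^ j) := Nat.mul_le_mul_left _ h1
      _ = _ := by rw [mul_pow]; ring
  exact Nat.le_of_mul_le_mul_left h3 (by positivity)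

lemma prime_le_of_dvd_choose {n j : ℕ}
    (h : ∀ p i : ℕ, p.Prime → j + 2 ≤ p → i < j → ¬ p ∣ n - i) {p : ℕ} (hp : p.Prime)
    (hpc : p ∣ n.choose j) : p ≤ j + 1 := by
  by_contra hlt
  have : p ∣ n.descFactorial j := by
    rw [Nat.descFactorial_eq_factorial_mul_choose]
    exact hpc.mul_left _
  rw [Nat.descFactorial_eq_prod_range, hp.prime.dvd_finsetProd_iff] at this
  obtain ⟨i, hi, hpi⟩ := this
  exact h p i hp (by omega) (mem_range.1 hi) hpi

lemma choose_le_pow_mul_prod {n j m : ℕ} (hjn : j ≤ n) (hn : 0 < n)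
    (h : ∀ p : ℕ, p.Prime → m ≤ p → p ∣ n.choose j → n < p ^ 2) :
    n.choose j ≤ n ^ Nat.primeCounting' m *
      ∏ p ∈ range (n + 1) with p.Prime ∧ m ≤ p ∧ p ∣ n.choose j, p := by
  classical
  have key : ∀ p ∈ range (n + 1), p ^ (n.choose j).factorization p ≤
      (if p.Prime ∧ p < m then n else 1) *
        (if p.Prime ∧ m ≤ p ∧ p ∣ n.choose j then p else 1) := by
    intro p _
    by_cases hp : p.Prime
    · rcases lt_or_ge p m with hpm | hpm
      · simpa [hp, hpm, hpm.not_ge] using Nat.pow_factorization_choose_le hn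
      · by_cases hd : p ∣ n.choose j
        · have := Nat.factorization_choose_le_one (k := j) (h p hp hpm hd)
          simpa [hp, hpm, hpm.not_gt, hd] using Nat.pow_le_pow_right hp.pos this
        · simp [Nat.factorization_eq_zero_of_not_dvd hd, hp, hpm.not_gt, hd]
    · simp [hp]
  rw [← Nat.prod_pow_factorization_choose n j hjn]
  refine (prod_le_prod' key).trans ?_
  rw [prod_mul_distrib, ← prod_filter, ← prod_filter, prod_const,
    Nat.prod_pow_factorization_choose n j hjn]
  refine Nat.mul_le_mul_right _ (Nat.pow_le_pow_right hn ?_)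
  rw [Nat.primeCounting', Nat.count_eq_card_filter_range]
  refine card_le_card fun p hp ↦ ?_
  simp only [mem_filter, mem_range] at hp ⊢
  exact ⟨hp.2.2, hp.2.1⟩

lemma primeCounting'_add_seven_le (m : ℕ) : Nat.primeCounting' (7 + m) ≤ 5 + 2 * (m / 6) := by
  have h := Nat.primeCounting'_add_le (a := 6) (k := 7) (by norm_num) (by norm_num) m
  have h7 : Nat.primeCounting' 7 = 3 := by decide
  have h6 : Nat.totient 6 = 2 := by decide
  rw [h7, h6] at h
  omega

lemma two_mul_primeCounting'_le {j : ℕ} (hj : 8 ≤ j) : 2 * Nat.primeCounting' (j + 2) ≤ j := by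
  rcases lt_or_ge j 20 with h | h
  · interval_cases j <;> decide
  · have := primeCounting'_add_seven_le (j - 5)
    rw [show 7 + (j - 5) = j + 2 by omega] at this
    omega

lemma pow_mul_lt_pow_of_add_two_le {n k j : ℕ} (hk : n + 1 = k ^ 2) (hk64 : 64 ≤ k) (hj : 3 ≤ j)
    (hjk : j + 2 ≤ k) : n ^ Nat.primeCounting' (j + 2) * j ^ j < n ^ j := by
  have hn : 4095 ≤ n := by nlinarith
  rcases lt_or_ge j 8 with h | h
  · have h3 : Nat.primeCounting' 5 = 2 := by decide
    have h4 : Nat.primeCounting' 6 = 3 := by decide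
    have h5 : Nat.primeCounting' 7 = 3 := by decide
    have h6 : Nat.primeCounting' 8 = 4 := by decide
    have h7 : Nat.primeCounting' 9 = 4 := by decide
    have aux (a b c : ℕ) (hc : c < 4095 ^ b) : n ^ a * c < n ^ (a + b) := by
      rw [pow_add]
      exact Nat.mul_lt_mul_of_pos_left (hc.trans_le (Nat.pow_le_pow_left hn b)) (by positivity)
    interval_cases j <;> simp only [Nat.reduceAdd, h3, h4, h5, h6, h7]
    · exact aux 2 1 _ (by norm_num)
    · exact aux 3 1 _ (by norm_num)
    · exact aux 3 2 _ (by norm_num)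
    · exact aux 4 2 _ (by norm_num)
    · exact aux 4 3 _ (by norm_num)
  · have hjn : j ^ 2 < n := by
      obtain ⟨d, rfl⟩ := Nat.exists_eq_add_of_le hjk
      nlinarith
    refine lt_of_pow_lt_pow_left₀ 2 (by positivity) ?_
    calc (n ^ Nat.primeCounting' (j + 2) * j ^ j) ^ 2
        = n ^ (2 * Nat.primeCounting' (j + 2)) * (j ^ 2) ^ j := by ring
      _ ≤ n ^ j * (j ^ 2) ^ j :=
        Nat.mul_le_mul_right _ (Nat.pow_le_pow_right (by omega) (two_mul_primeCounting'_le h))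
      _ < n ^ j * n ^ j :=
        Nat.mul_lt_mul_of_pos_left (Nat.pow_lt_pow_left hjn (by omega)) (by positivity)
      _ = (n ^ j) ^ 2 := by ring

lemma choose_le_pow_mul_four_pow {n k j M : ℕ} (hk : n + 1 = k ^ 2) (hk0 : 2 ≤ k)
    (hjn : 2 * j ≤ n) (hc : ∀ p : ℕ, p.Prime → p ∣ n.choose j → p ≤ j + 1)
    (hM : ∀ p : ℕ, p.Prime → k ≤ p → p ∣ n.choose j → p ≤ j → p ≤ M) :
    n.choose j ≤ n ^ Nat.primeCounting' k * ((j + 1) * 4 ^ M) := by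
  have hn : 0 < n := by nlinarith
  refine (choose_le_pow_mul_prod (m := k) (by omega) hn fun p _ hkp _ ↦ ?_).trans
    (Nat.mul_le_mul_left _ ?_)
  · have := Nat.pow_le_pow_left hkp 2
    omega
  have hsub : {p ∈ range (n + 1) | p.Prime ∧ k ≤ p ∧ p ∣ n.choose j} ⊆
      insert (j + 1) {p ∈ range (M + 1) | p.Prime} := by
    intro p hp
    simp only [mem_filter, mem_range, mem_insert] at hp ⊢
    have h1 := hc p hp.2.1 hp.2.2.2
    have h2 := hM p hp.2.1 hp.2.2.1 hp.2.2.2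
    by_cases h : p = j + 1
    · exact .inl h
    · exact .inr ⟨by have := h2 (by omega); omega, hp.2.1⟩
  calc _ ≤ ∏ p ∈ insert (j + 1) {p ∈ range (M + 1) | p.Prime}, p := by
        refine prod_le_prod_of_subset_of_one_le' hsub fun p hp _ ↦ ?_
        rcases mem_insert.1 hp with rfl | hp
        · omega
        · exact (mem_filter.1 hp).2.one_lt.le
    _ ≤ (j + 1) * primorial M := by
        by_cases h : j + 1 ∈ {p ∈ range (M + 1) | p.Prime}
        · rw [insert_eq_of_mem h]
          exact Nat.le_mul_of_pos_left _ (by omega)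
        · rw [prod_insert h]
          rfl
    _ ≤ _ := Nat.mul_le_mul_left _ (primorial_le_four_pow M)

lemma le_mul_log_sub_log {a b x c T : ℝ} (ha : 0 < a) (hax : a ≤ x) (hxb : x ≤ b)
    (hTa : T ≤ a * (Real.log c - Real.log a)) (hTb : T ≤ b * (Real.log c - Real.log b)) :
    T ≤ x * (Real.log c - Real.log x) := by
  have hf : ConcaveOn ℝ (Set.Ici (0 : ℝ)) fun y ↦ Real.log c * y + Real.negMulLog y :=
    ((LinearMap.mul ℝ ℝ (Real.log c)).concaveOn (convex_Ici 0)).add Real.concaveOn_negMulLog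
  have h := hf.min_le_of_mem_Icc ha.le (ha.le.trans (hax.trans hxb)) ⟨hax, hxb⟩
  simp only [Real.negMulLog] at h
  rcases min_le_iff.1 h with h | h <;> linarith

lemma two_fifths_le_log : (2 / 5 : ℝ) ≤ Real.log (3 / 2) := by
  have h : Real.log (2 ^ 7) ≤ Real.log ((3 / 2) ^ 12) :=
    Real.log_le_log (by norm_num) (by norm_num)
  rw [Real.log_pow, Real.log_pow] at h
  have := Real.log_two_gt_d9
  push_cast at h
  linarith

lemma log_bounds {k : ℝ} (hk : 64 ≤ k) :
    6 * Real.log 2 ≤ Real.log k ∧ Real.log k ≤ 6 * Real.log 2 + k / 64 - 1 := by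
  have h64 : Real.log 64 = 6 * Real.log 2 := by
    rw [show (64 : ℝ) = 2 ^ 6 by norm_num, Real.log_pow]; norm_num
  refine ⟨h64 ▸ Real.log_le_log (by norm_num) hk, ?_⟩
  have := Real.log_le_sub_one_of_pos (show 0 < k / 64 by linarith)
  rw [Real.log_div (by linarith) (by norm_num), h64] at this
  linarith

lemma mul_log_two_mul_le {n k j M : ℕ} (hk : n + 1 = k ^ 2) (hk64 : 64 ≤ k) (hj : 1 ≤ j)
    (hjn : 2 * j ≤ n) (hc : ∀ p : ℕ, p.Prime → p ∣ n.choose j → p ≤ j + 1)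
    (hM : ∀ p : ℕ, p.Prime → k ≤ p → p ∣ n.choose j → p ≤ j → p ≤ M) :
    j * (Real.log (2 * n) - Real.log j) ≤
      2 / 3 * (k + 14) * Real.log k + M * (2 * Real.log 2) := by
  have hn : 4095 ≤ n := by nlinarith
  have hnat : (2 * n) ^ j ≤ n ^ (Nat.primeCounting' k + 2) * 4 ^ M * j ^ j := by
    calc (2 * n) ^ j ≤ 2 * j * n.choose j * j ^ j := two_mul_pow_le hj hjn
      _ ≤ 2 * j * (n ^ Nat.primeCounting' k * ((j + 1) * 4 ^ M)) * j ^ j := by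
        gcongr
        exact choose_le_pow_mul_four_pow hk (by omega) hjn hc hM
      _ = n ^ Nat.primeCounting' k * (2 * j * (j + 1)) * 4 ^ M * j ^ j := by ring
      _ ≤ n ^ Nat.primeCounting' k * (n * n) * 4 ^ M * j ^ j := by
        gcongr
        omega
      _ = _ := by ring
  have hpi : 3 * (Nat.primeCounting' k + 2) ≤ k + 14 := by
    have := primeCounting'_add_seven_le (k - 7)
    rw [show 7 + (k - 7) = k by omega] at this
    omega
  have hn0 : (0 : ℝ) < n := by exact_mod_cast (by omega : 0 < n)
  have hj0 : (0 : ℝ) < j := by exact_mod_cast hj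
  have hlog : Real.log n ≤ 2 * Real.log k := by
    have : Real.log n ≤ Real.log (k ^ 2) :=
      Real.log_le_log hn0 (by exact_mod_cast (by omega : n ≤ k ^ 2))
    simpa [Real.log_pow] using this
  have hlogk : 0 ≤ Real.log k := Real.log_natCast_nonneg k
  have hreal : Real.log ((2 * n : ℝ) ^ j) ≤
      Real.log ((n : ℝ) ^ (Nat.primeCounting' k + 2) * 4 ^ M * j ^ j) :=
    Real.log_le_log (by positivity) (by exact_mod_cast hnat)
  rw [Real.log_mul (by positivity) (by positivity), Real.log_mul (by positivity) (by positivity),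
    Real.log_pow, Real.log_pow, Real.log_pow, Real.log_pow,
    show (4 : ℝ) = 2 ^ 2 by norm_num, Real.log_pow] at hreal
  have h1 : ((Nat.primeCounting' k + 2 : ℕ) : ℝ) * Real.log n ≤
      (k + 14) / 3 * (2 * Real.log k) := by
    have hpi' : 3 * ((Nat.primeCounting' k + 2 : ℕ) : ℝ) ≤ k + 14 := by exact_mod_cast hpi
    calc _ ≤ ((Nat.primeCounting' k + 2 : ℕ) : ℝ) * (2 * Real.log k) := by gcongr
      _ ≤ _ := by
        gcongr
        linarith
  push_cast at hreal h1
  linarith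

lemma prime_le_third_of_dvd_choose {n k j p : ℕ} (hk64 : 64 ≤ k) (hjn : 2 * j ≤ n)
    (hp : p.Prime) (hkp : k ≤ p) (hpc : p ∣ n.choose j) (hpj : p ≤ j) : p ≤ n / 3 := by
  by_contra hlt
  have h0 := Nat.factorization_choose_of_lt_three_mul (n := n) (k := j) (p := p) (by omega) hpj
    (by omega) (by omega)
  exact (hp.factorization_pos_of_dvd (Nat.choose_ne_zero (by omega)) hpc).ne' h0

lemma endpoint_lt {k : ℝ} (hk : 64 ≤ k) :
    2 / 3 * (k + 14) * Real.log k < (k - 1) * (Real.log (k + 1) - Real.log 2) ∧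
      2 / 3 * (k + 14) * Real.log k < (k ^ 2 - 1) / 3 * (2 / 5) := by
  obtain ⟨h1, h2⟩ := log_bounds hk
  have h3 := Real.log_two_gt_d9
  have h4 := Real.log_two_lt_d9
  have h5 : Real.log k ≤ Real.log (k + 1) := Real.log_le_log (by linarith) (by linarith)
  constructor <;> nlinarith

lemma exists_prime_le_of_dvd_choose {n k j : ℕ} (hk : n + 1 = k ^ 2) (hk64 : 64 ≤ k)
    (hkj : k ≤ j + 1) (hjn : 2 * j ≤ n) :
    ∃ p : ℕ, p.Prime ∧ p ∣ n.choose j ∧ j + 2 ≤ p := by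
  by_contra! hcon
  have hc : ∀ p : ℕ, p.Prime → p ∣ n.choose j → p ≤ j + 1 := fun p hp hpc ↦ by
    have := hcon p hp hpc
    omega
  have hk' : (64 : ℝ) ≤ k := by exact_mod_cast hk64
  have hkj' : (k : ℝ) - 1 ≤ j := by
    have : (k : ℝ) ≤ j + 1 := by exact_mod_cast hkj
    linarith
  have hjn' : (2 : ℝ) * j ≤ n := by exact_mod_cast hjn
  have hn : (n : ℝ) = k ^ 2 - 1 := by
    rw [eq_sub_iff_add_eq]
    exact_mod_cast hk
  obtain ⟨he1, he2⟩ := endpoint_lt hk'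
  rw [← hn] at he2
  have hn0 : (0 : ℝ) < n := by nlinarith
  have h32 := two_fifths_le_log
  have hl2 := Real.log_two_gt_d9
  have hl2' := Real.log_two_lt_d9
  have hl32 : Real.log (3 / 2) = Real.log 3 - Real.log 2 :=
    Real.log_div (by norm_num) (by norm_num)
  have hlog2n : Real.log (2 * n) = Real.log 2 + Real.log n :=
    Real.log_mul (by norm_num) hn0.ne'
  have hlogn2 : Real.log (n / 2) = Real.log n - Real.log 2 :=
    Real.log_div hn0.ne' (by norm_num)
  have hlogn3 : Real.log (n / 3) = Real.log n - Real.log 3 :=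
    Real.log_div hn0.ne' (by norm_num)
  rcases le_or_gt (3 * j) n with h3 | h3
  · have h3' : (3 : ℝ) * j ≤ n := by exact_mod_cast h3
    have hub := mul_log_two_mul_le hk hk64 (by omega) hjn hc (M := j) fun p _ _ _ h ↦ h
    have hlogn : Real.log n = Real.log (k + 1) + Real.log (k - 1) := by
      rw [← Real.log_mul (by linarith) (by linarith), hn]
      ring_nf
    have hlb := le_mul_log_sub_log (c := n / 2) (x := j)
      (T := min ((k - 1) * (Real.log (n / 2) - Real.log (k - 1)))
        (n / 3 * (Real.log (n / 2) - Real.log (n / 3)))) (by linarith) hkj'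
      (by linarith : (j : ℝ) ≤ n / 3) (min_le_left _ _) (min_le_right _ _)
    have : 2 / 3 * (k + 14) * Real.log k < min ((k - 1) * (Real.log (n / 2) - Real.log (k - 1)))
        (n / 3 * (Real.log (n / 2) - Real.log (n / 3))) := by
      rw [lt_min_iff, hlogn3, hlogn2]
      refine ⟨by rw [hlogn]; linarith, ?_⟩
      nlinarith
    rw [hlogn2] at *
    rw [hlog2n] at hub
    linarith
  · have h3' : (n : ℝ) / 3 ≤ j := by
      have : (n : ℝ) < 3 * j := by exact_mod_cast h3
      linarith
    have hub := mul_log_two_mul_le hk hk64 (by omega) hjn hc (M := n / 3)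
      fun p hp hkp hpc hpj ↦ prime_le_third_of_dvd_choose hk64 hjn hp hkp hpc hpj
    have hM : ((n / 3 : ℕ) : ℝ) ≤ n / 3 := Nat.cast_div_le
    have hlb := le_mul_log_sub_log (c := 2 * n) (x := j)
      (T := n / 3 * (2 / 5) + n / 3 * (2 * Real.log 2)) (by linarith) h3'
      (by linarith : (j : ℝ) ≤ n / 2) (by rw [hlogn3, hlog2n]; nlinarith)
      (by rw [hlogn2, hlog2n]; nlinarith)
    nlinarith

lemma exists_prime_dvd_sub_of_three_le {n k j : ℕ} (hk : n + 1 = k ^ 2) (hk64 : 64 ≤ k)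
    (hj : 3 ≤ j) (hjn : 2 * j ≤ n) :
    ∃ p i : ℕ, p.Prime ∧ j + 2 ≤ p ∧ i < j ∧ p ∣ n - i := by
  by_contra! hcon
  have hc : ∀ p : ℕ, p.Prime → p ∣ n.choose j → p ≤ j + 1 := fun p hp hpc ↦
    prime_le_of_dvd_choose hcon hp hpc
  rcases le_or_gt (j + 2) k with hjk | hjk
  · have hub := choose_le_pow_mul_prod (m := j + 2) (by omega : j ≤ n) (by omega)
      fun p hp hjp hpc ↦ absurd (hc p hp hpc) (by omega)
    rw [filter_false_of_mem fun p _ ⟨hp, hjp, hpc⟩ ↦ absurd (hc p hp hpc) (by omega),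
      prod_empty, mul_one] at hub
    exact (pow_mul_lt_pow_of_add_two_le hk hk64 hj hjk).not_ge
      ((pow_le_pow_mul_choose (by omega)).trans (Nat.mul_le_mul_right _ hub))
  · obtain ⟨p, hp, hpc, hjp⟩ := exists_prime_le_of_dvd_choose hk hk64 (by omega) hjn
    exact absurd (hc p hp hpc) (by omega)

theorem exists_prime_dvd_sub_of_succ_eq_sq {n k j : ℕ} (hk : n + 1 = k ^ 2) (hj : 1 ≤ j)
    (hjn : 2 * j ≤ n) (h8 : ¬ (n = 8 ∧ j = 1)) :
    ∃ p i : ℕ, p.Prime ∧ j + 2 ≤ p ∧ i < j ∧ p ∣ n - i := by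
  rcases lt_or_ge k 64 with hk64 | hk64
  · exact exists_prime_dvd_sub_of_lt hk hj hjn h8 hk64
  obtain rfl | rfl | hj3 : j = 1 ∨ j = 2 ∨ 3 ≤ j := by omega
  · exact exists_prime_dvd_sub_one hk (by omega)
  · exact exists_prime_dvd_sub_two hk (by omega)
  · exact exists_prime_dvd_sub_of_three_le hk hk64 hj3 hjn

section Irreducibility

theorem diagContract_eight_eq :
    diagContract 8 = 9 * (X ^ 4 - 28 * X ^ 3 + 210 * X ^ 2 - 420 * X + 105) ^ 2
      - 8 * X * (X ^ 4 - 28 * X ^ 3 + 210 * X ^ 2 - 420 * X + 105)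
        * (X ^ 3 - 21 * X ^ 2 + 105 * X - 105)
      + 64 * X * (X ^ 3 - 21 * X ^ 2 + 105 * X - 105) ^ 2 := by
  have h (n : ℕ) : hermite (n + 2) = X * hermite (n + 1) - ((n : ℤ[X]) + 1) * hermite n := by
    rw [hermite_add_two]
    simp
  have h2 : hermite 2 = X ^ 2 - 1 := by rw [h 0]; simp; ring
  have h3 : hermite 3 = X ^ 3 - 3 * X := by rw [h 1, h2]; simp; ring
  have h4 : hermite 4 = X ^ 4 - 6 * X ^ 2 + 3 := by rw [h 2, h3, h2]; push_cast; ring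
  have h5 : hermite 5 = X ^ 5 - 10 * X ^ 3 + 15 * X := by rw [h 3, h4, h3]; push_cast; ring
  have h6 : hermite 6 = X ^ 6 - 15 * X ^ 4 + 45 * X ^ 2 - 15 := by
    rw [h 4, h5, h4]; push_cast; ring
  have h7 : hermite 7 = X ^ 7 - 21 * X ^ 5 + 105 * X ^ 3 - 105 * X := by
    rw [h 5, h6, h5]; push_cast; ring
  have h8 : hermite 8 = X ^ 8 - 28 * X ^ 6 + 210 * X ^ 4 - 420 * X ^ 2 + 105 := by
    rw [h 6, h7, h6]; push_cast; ring
  apply expand_injective two_pos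
  rw [expand_diagContract, diagWronskian, hermite_derivative_succ 7, h8, h7]
  simp only [map_add, map_sub, map_mul, map_pow, expand_X, map_ofNat, map_natCast, map_one]
  push_cast
  ring

theorem diagContract_eight_not_dvd {g : ℤ[X]} (hg : g.Monic) (hd : g.natDegree = 1) :
    ¬ g ∣ diagContract 8 := by
  rintro ⟨f, hf⟩
  have hr : eval (-g.coeff 0) g = 0 := by
    have h1 := hg.as_sum
    rw [hd] at h1
    rw [h1]
    simp
  have h0 := congrArg (fun P => ((eval (-g.coeff 0) P : ℤ) : ZMod 13)) hf
  simp only [eval_mul, hr, zero_mul, diagContract_eight_eq, eval_add, eval_sub, eval_pow, eval_X,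
    eval_ofNat, Int.cast_zero] at h0
  push_cast at h0
  generalize ((g.coeff 0 : ℤ) : ZMod 13) = c at h0
  revert c
  decide

theorem diagContract_coeff_zero (n : ℕ) : (diagContract n).coeff 0 = (diagWronskian n).coeff 0 := by
  rw [diagContract, coeff_contract two_ne_zero, zero_mul]

theorem dvd_coeff_zero_of_dvd_diagContract {p : ℕ} [hp : Fact p.Prime] (hodd : Odd p)
    {q u : ℕ} {g : ℤ[X]} (hg : g.Monic) (hn : 1 ≤ q * p + u) (hd : g ∣ diagContract (q * p + u))
    (hu : u < g.natDegree) : (p : ℤ) ∣ g.coeff 0 := by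
  obtain ⟨f, hf⟩ := hd
  by_contra hcon
  have hF := monic_diagContract hn
  have hfm : f.Monic := by
    rw [hf] at hF
    exact hg.of_mul_monic_left hF
  have hdeg : g.natDegree + f.natDegree = q * p + u := by
    rw [← hg.natDegree_mul hfm, ← hf, natDegree_diagContract hn]
  have hmap := map_diagContract_mul_prime_add p hodd q u
  rw [hf, Polynomial.map_mul] at hmap
  have h1 : ¬ (X : (ZMod p)[X]) ∣ g.map (Int.castRingHom (ZMod p)) := by
    rw [X_dvd_iff, coeff_map, eq_intCast, ZMod.intCast_zmod_eq_zero_iff_dvd]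
    exact hcon
  have h2 := prime_X.pow_dvd_of_dvd_mul_left (q * p) h1 (Dvd.intro _ hmap.symm)
  have h3 := natDegree_le_of_dvd h2 (hfm.map _).ne_zero
  rw [natDegree_X_pow, hfm.natDegree_map] at h3
  omega

theorem irreducible_diagContract {n k : ℕ} (hn : 1 ≤ n) (hk : n + 1 = k ^ 2)
    (h0 : (diagWronskian n).coeff 0 ≠ 0) : Irreducible (diagContract n) := by
  have hF := monic_diagContract hn
  have hFd := natDegree_diagContract hn
  refine (hF.irreducible_iff_lt_natDegree_lt ?_).2 fun g hg hgd hdvd => ?_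
  · intro h
    rw [h, natDegree_one] at hFd
    omega
  rw [hFd, Finset.mem_Ioc] at hgd
  by_cases h8 : n = 8 ∧ g.natDegree = 1
  · obtain ⟨rfl, h1⟩ := h8
    exact diagContract_eight_not_dvd hg h1 hdvd
  have hg0 : g.coeff 0 ≠ 0 := by
    rw [← diagContract_coeff_zero] at h0
    obtain ⟨f, hf⟩ := hdvd
    rw [hf, mul_coeff_zero] at h0
    exact left_ne_zero_of_mul h0
  obtain ⟨p, i, hp, hpj, hij, q, hq⟩ :=
    exists_prime_dvd_sub_of_succ_eq_sq hk hgd.1 (by omega) h8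
  have : Fact p.Prime := ⟨hp⟩
  have hodd : Odd p := hp.odd_of_ne_two (by omega)
  obtain ⟨h, hph⟩ := hodd
  have hnq : n = q * p + i := by rw [mul_comm]; omega
  have hdvd' : g ∣ diagContract (q * p + i) := hnq ▸ hdvd
  exact not_dvd_coeff_zero_of_dvd_diagContract hph (by omega) hg hdvd' (by omega) hg0
    (dvd_coeff_zero_of_dvd_diagContract ⟨h, hph⟩ hg (by omega) hdvd' hij)

end Irreducibility

/-- If `n ≥ 1` and `n + 1` is a perfect square, then the remainder
polynomial `R_{n,n}` of the Wronskian Hermite polynomial `He_{(n,n)}` is irreducible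
in `ℤ[X]`.  Here `HeL` is `He_{(n,n)}`, characterized by `Δ(n_λ) · HeL = Wr[...]`, and
`RL` is the remainder polynomial, characterized by `HeL = X^{s_λ} · RL`, `RL(0) ≠ 0`. -/
theorem stmt0 (n : ℕ) (hn : 1 ≤ n) (hsq : ∃ k : ℕ, n + 1 = k ^ 2)
    (HeL RL : Polynomial ℤ)
    (hHe : Polynomial.C (vand (degSeq ![n, n])) * HeL = wronskHe (degSeq ![n, n]))
    (hR : HeL = Polynomial.X ^ sStat (degSeq ![n, n]) * RL)
    (hR0 : RL.coeff 0 ≠ 0) :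
    Irreducible RL := by
  obtain ⟨k, hk⟩ := hsq
  have hRL : RL = diagWronskian n := by
    rw [← wronskHe_degSeq_diag, ← hHe, hR, vand_degSeq_diag, sStat_degSeq_diag]
    simp
  subst hRL
  exact irreducible_diagWronskian hn hk hR0 (irreducible_diagContract hn hk hR0)
end

section
/- Suppose n ≥ 1000 and n = 2^ℓ − 1 for some integer ℓ. Then R_{n,2}(x) has no factor of degree 1 or 2 in ℤ[x]. -/
open Polynomial Finset

open scoped Nat

lemma He_add_two (n : ℕ) : He (n + 2) = X * He (n + 1) - C ((n : ℤ) + 1) * He n := by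
  rw [He]

lemma derivative_He_succ (n : ℕ) : derivative (He (n + 1)) = C ((n : ℤ) + 1) * He n := by
  induction n using Nat.twoStepInduction with
  | zero => simp [He]
  | one => simp [He]; ring
  | more n h0 h1 =>
    rw [He_add_two (n + 1), derivative_sub, derivative_mul, derivative_mul, h1, h0,
      He_add_two n]
    simp
    ring

lemma He_ode (n : ℕ) :
    derivative (derivative (He (n + 2))) - X * derivative (He (n + 2))
      + C ((n : ℤ) + 2) * He (n + 2) = 0 := by
  rw [derivative_He_succ, derivative_mul, derivative_He_succ, He_add_two]
  simp
  ring

lemma He_coeff_add_two (n k : ℕ) :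
    ((k : ℤ) + 2) * (k + 1) * (He (n + 2)).coeff (k + 2)
      = (k - (n + 2)) * (He (n + 2)).coeff k := by
  have h := congrArg (fun q => coeff q k) (He_ode n)
  simp only [coeff_add, coeff_sub, coeff_C_mul, coeff_derivative, coeff_zero] at h
  cases k with
  | zero =>
    simp at h ⊢
    linarith
  | succ k =>
    rw [coeff_X_mul, coeff_derivative] at h
    push_cast at h ⊢
    rw [show k + 1 + 1 + 1 = k + 1 + 2 from rfl] at h
    linarith

lemma coeff_He_of_odd_add {n k : ℕ} (h : Odd (n + k)) : (He n).coeff k = 0 := by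
  induction n using Nat.twoStepInduction generalizing k with
  | zero =>
    have : k ≠ 0 := by rintro rfl; simp at h
    simp [He, coeff_one, this]
  | one =>
    have : 1 ≠ k := by rintro rfl; revert h; decide
    simp [He, coeff_X, this]
  | more n h0 h1 =>
    have hk : Odd (n + k) := by rw [Nat.odd_iff] at h ⊢; omega
    rw [He_add_two, coeff_sub, coeff_C_mul, h0 hk]
    cases k with
    | zero => simp
    | succ k =>
      have hk' : Odd (n + 1 + k) := by rw [Nat.odd_iff] at h ⊢; omega
      rw [coeff_X_mul, h1 hk']
      simp

lemma natDegree_He_le (n : ℕ) : (He n).natDegree ≤ n := by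
  induction n using Nat.twoStepInduction with
  | zero => simp [He]
  | one => simp [He]
  | more n h0 h1 =>
    rw [He_add_two]
    refine (natDegree_sub_le _ _).trans (max_le ?_ ?_)
    · refine natDegree_mul_le.trans ?_
      rw [natDegree_X]; omega
    · refine (natDegree_C_mul_le _ _).trans ?_
      omega

lemma coeff_He_self (n : ℕ) : (He n).coeff n = 1 := by
  induction n using Nat.twoStepInduction with
  | zero => simp [He]
  | one => simp [He]
  | more n h0 h1 =>
    have h : (He n).coeff (n + 2) = 0 :=
      coeff_eq_zero_of_natDegree_lt ((natDegree_He_le n).trans_lt (by omega))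
    rw [He_add_two, coeff_sub, coeff_C_mul, h, show n + 2 = (n + 1) + 1 from rfl, coeff_X_mul, h1]
    simp

lemma odd_coeff_zero_He (m : ℕ) : Odd ((He (2 * m)).coeff 0) := by
  induction m with
  | zero => simp [He]
  | succ m ih =>
    rw [show 2 * (m + 1) = 2 * m + 2 by ring, He_add_two, coeff_sub, coeff_C_mul,
      mul_coeff_zero, coeff_X_zero, zero_mul, zero_sub]
    refine (Odd.mul ?_ ih).neg
    push_cast
    exact ⟨m, rfl⟩

section ModPrime

variable (p : ℕ)

lemma map_He_add {n : ℕ} (h : p ∣ n) (r : ℕ) :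
    (He (n + r)).map (Int.castRingHom (ZMod p))
      = (He n).map (Int.castRingHom (ZMod p)) * (He r).map (Int.castRingHom (ZMod p)) := by
  have hn : (n : (ZMod p)[X]) = 0 := by
    rw [← C_eq_natCast, (ZMod.natCast_eq_zero_iff _ _).2 h, C_0]
  induction r using Nat.twoStepInduction with
  | zero => simp [He]
  | one =>
    cases n with
    | zero => simp [He]
    | succ n =>
      push_cast at hn
      rw [He_add_two]
      simp [He]
      linear_combination (-Polynomial.map (Int.castRingHom (ZMod p)) (He n)) * hn
  | more r h0 h1 =>
    rw [← add_assoc] at *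
    rw [He_add_two, He_add_two]
    simp only [Polynomial.map_sub, Polynomial.map_mul, h0, h1]
    simp
    linear_combination (-Polynomial.map (Int.castRingHom (ZMod p)) (He n)
      * Polynomial.map (Int.castRingHom (ZMod p)) (He r)) * hn

lemma map_He_prime [hp : Fact p.Prime] (hp2 : p ≠ 2) :
    (He p).map (Int.castRingHom (ZMod p)) = X ^ p := by
  have hodd := hp.out.odd_of_ne_two hp2
  ext k
  rw [coeff_map, coeff_X_pow]
  split_ifs with hk
  · subst hk; simp [coeff_He_self]
  rcases lt_or_gt_of_ne hk with hk | hk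
  · cases k with
    | zero => simp [coeff_He_of_odd_add (show Odd (p + 0) from hodd)]
    | succ k =>
      obtain ⟨q, rfl⟩ : ∃ q, p = q + 1 := ⟨p - 1, by omega⟩
      have h := congrArg (fun f => ((coeff f k : ℤ) : ZMod (q + 1))) (derivative_He_succ q)
      have hq : ((q : ZMod (q + 1)) + 1) = 0 := by
        exact_mod_cast CharP.cast_eq_zero (ZMod (q + 1)) (q + 1)
      simp only [coeff_derivative, coeff_C_mul] at h
      push_cast at h
      rw [hq, zero_mul] at h
      rcases mul_eq_zero.1 h with h | h
      · simpa using h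
      · exfalso
        have h' : ((k + 1 : ℕ) : ZMod (q + 1)) = 0 := by exact_mod_cast h
        rw [ZMod.natCast_eq_zero_iff] at h'
        exact absurd (Nat.le_of_dvd (by omega) h') (by omega)
  · rw [coeff_eq_zero_of_natDegree_lt ((natDegree_He_le p).trans_lt hk)]
    simp

lemma map_He_of_dvd [hp : Fact p.Prime] (hp2 : p ≠ 2) {n : ℕ} (h : p ∣ n) :
    (He n).map (Int.castRingHom (ZMod p)) = X ^ n := by
  obtain ⟨q, rfl⟩ := h
  induction q with
  | zero => simp [He]
  | succ q ih =>
    rw [mul_add, mul_one, map_He_add p (dvd_mul_right _ _), ih, map_He_prime p hp2, pow_add]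

end ModPrime

lemma sub_one_mul_padicValNat_factorial_odd_le {p : ℕ} [hp : Fact p.Prime] (j : ℕ) :
    (p - 1) * padicValNat p (2 * j + 1)! ≤ 2 * j := by
  have := sub_one_mul_padicValNat_factorial_lt_of_ne_zero (p := p) (n := 2 * j + 1) (by omega)
  omega

lemma norm_intCast_padicAlgCl (p : ℕ) [Fact p.Prime] (z : ℤ) :
    ‖(z : PadicAlgCl p)‖ = ‖(z : ℚ_[p])‖ := by
  rw [← map_intCast (algebraMap ℚ_[p] (PadicAlgCl p)), PadicAlgCl.norm_extends]

/-- A small `p`-adic root cannot exist when the coefficients of `R` are small multiples of the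
constant one. -/
lemma aeval_ne_zero_of_norm_sq_le (p : ℕ) [hp : Fact p.Prime] {R : ℤ[X]} {e : ℕ}
    (hv : ∀ j, 1 ≤ j → padicValNat p (2 * j + 1)! < e * j)
    (hodd : ∀ k, Odd k → R.coeff k = 0) (h0 : R.coeff 0 ≠ 0)
    (hz : ∀ j, ∃ z : ℤ, ((2 * j + 1)! : ℤ) * R.coeff (2 * j) = R.coeff 0 * z)
    {α : PadicAlgCl p} (hα : ‖α‖ ^ 2 ≤ ((p : ℝ) ^ e)⁻¹) : aeval α R ≠ 0 := by
  intro h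
  have hp1 : (1 : ℝ) < p := by exact_mod_cast hp.out.one_lt
  have hp0 : (0 : ℝ) < p := by linarith
  have hA : 0 < ‖(R.coeff 0 : PadicAlgCl p)‖ := by
    rw [norm_pos_iff]; exact_mod_cast h0
  have hterm : ∀ k, ‖(R.coeff (k + 1) : PadicAlgCl p) * α ^ (k + 1)‖
      < ‖(R.coeff 0 : PadicAlgCl p)‖ := by
    intro k
    rcases Nat.even_or_odd' (k + 1) with ⟨j, hj | hj⟩
    · rw [hj]
      obtain ⟨z, hz⟩ := hz j
      have hz' : ‖(((2 * j + 1)! : ℤ) : PadicAlgCl p)‖ * ‖(R.coeff (2 * j) : PadicAlgCl p)‖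
          ≤ ‖(R.coeff 0 : PadicAlgCl p)‖ := by
        rw [← norm_mul, ← Int.cast_mul, hz, Int.cast_mul, norm_mul]
        refine mul_le_of_le_one_right (norm_nonneg _) ?_
        rw [norm_intCast_padicAlgCl]
        exact Padic.norm_int_le_one z
      have hf : ‖(((2 * j + 1)! : ℤ) : PadicAlgCl p)‖
          = ((p : ℝ) ^ padicValNat p (2 * j + 1)!)⁻¹ := by
        rw [norm_intCast_padicAlgCl, Int.cast_natCast,
          Padic.norm_eq_zpow_neg_valuation (by exact_mod_cast Nat.factorial_ne_zero _),
          Padic.valuation_natCast, zpow_neg, zpow_natCast]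
      have hpow : ‖α ^ (2 * j)‖ ≤ ((p : ℝ) ^ (e * j))⁻¹ := by
        rw [norm_pow, pow_mul, pow_mul, ← inv_pow]
        exact pow_le_pow_left₀ (by positivity) hα j
      have hlt : ((p : ℝ) ^ (e * j))⁻¹ < ((p : ℝ) ^ padicValNat p (2 * j + 1)!)⁻¹ :=
        inv_strictAnti₀ (by positivity) (pow_lt_pow_right₀ hp1 (hv j (by omega)))
      rw [hf] at hz'
      rw [norm_mul]
      rcases (norm_nonneg (R.coeff (2 * j) : PadicAlgCl p)).eq_or_lt with h' | h'
      · rw [← h', zero_mul]; exact hA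
      · calc _ < ‖(R.coeff (2 * j) : PadicAlgCl p)‖ * ((p : ℝ) ^ padicValNat p (2 * j + 1)!)⁻¹ :=
            mul_lt_mul_of_pos_left (hpow.trans_lt hlt) h'
          _ ≤ _ := by rw [mul_comm]; exact hz'
    · rw [hodd (k + 1) ⟨j, hj⟩]
      simpa using hA
  rw [aeval_eq_sum_range, sum_range_succ'] at h
  simp only [zsmul_eq_mul, pow_zero, mul_one] at h
  have hsum : ‖∑ k ∈ range R.natDegree, (R.coeff (k + 1) : PadicAlgCl p) * α ^ (k + 1)‖
      < ‖(R.coeff 0 : PadicAlgCl p)‖ := by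
    rcases (range R.natDegree).eq_empty_or_nonempty with he | hne
    · rw [he]; simpa using hA
    · obtain ⟨i, -, hi⟩ := IsUltrametricDist.exists_norm_finsetSum_le_of_nonempty hne
        (fun k => (R.coeff (k + 1) : PadicAlgCl p) * α ^ (k + 1))
      exact hi.trans_lt (hterm i)
  rw [eq_neg_of_add_eq_zero_left h, norm_neg] at hsum
  exact lt_irrefl _ hsum

lemma not_pow_dvd_coeff_zero_of_dvd (p : ℕ) [hp : Fact p.Prime] {R : ℤ[X]} {e : ℕ}
    (hv : ∀ j, 1 ≤ j → padicValNat p (2 * j + 1)! < e * j)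
    (hodd : ∀ k, Odd k → R.coeff k = 0) (h0 : R.coeff 0 ≠ 0)
    (hz : ∀ j, ∃ z : ℤ, ((2 * j + 1)! : ℤ) * R.coeff (2 * j) = R.coeff 0 * z)
    {b c : ℤ} (hg : X ^ 2 + C b * X + C c ∣ R) : ¬ (p : ℤ) ^ e ∣ c := by
  intro hc
  obtain ⟨s, hs⟩ := IsAlgClosed.exists_eq_mul_self ((b : PadicAlgCl p) ^ 2 - 4 * c)
  have key : ∀ β : PadicAlgCl p, β ^ 2 + b * β + c = 0 → ¬ ‖β‖ ^ 2 ≤ ((p : ℝ) ^ e)⁻¹ := by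
    intro β hβ hle
    refine aeval_ne_zero_of_norm_sq_le p hv hodd h0 hz hle ?_
    obtain ⟨q, rfl⟩ := hg
    simp [hβ]
  have k1 := key ((-b + s) / 2) (by field_simp; linear_combination -hs)
  have k2 := key ((-b - s) / 2) (by field_simp; linear_combination -hs)
  have hprod : ‖((-b + s) / 2 : PadicAlgCl p)‖ * ‖((-b - s) / 2 : PadicAlgCl p)‖
      ≤ ((p : ℝ) ^ e)⁻¹ := by
    rw [← norm_mul, show ((-b + s) / 2 : PadicAlgCl p) * ((-b - s) / 2) = c by
      field_simp; linear_combination hs, norm_intCast_padicAlgCl]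
    have := (Padic.norm_int_le_pow_iff_dvd (p := p) c e).2 (by exact_mod_cast hc)
    simpa [zpow_neg] using this
  push Not at k1 k2
  have hq : (0 : ℝ) ≤ ((p : ℝ) ^ e)⁻¹ := by positivity
  have := mul_lt_mul'' k1 k2 hq hq
  have h2 := mul_le_mul hprod hprod (by positivity) hq
  nlinarith

lemma He_eval_I (n : ℕ) : ∃ a b : ℕ, 0 < a ∧ a < b ∧ b < (n + 3) * a ∧
    aeval Complex.I (He (n + 2)) = Complex.I ^ (n + 2) * a ∧
    aeval Complex.I (He (n + 3)) = Complex.I ^ (n + 3) * b := by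
  have hI := Complex.I_sq
  have h2' : aeval Complex.I (2 : ℤ[X]) = 2 := map_ofNat _ 2
  induction n with
  | zero =>
    refine ⟨2, 4, by norm_num, by norm_num, by norm_num, ?_, ?_⟩
    · simp [He]; norm_num
    · simp [He, pow_succ, h2']; ring_nf
  | succ n ih =>
    obtain ⟨a, b, ha, hab, hb, h1, h2⟩ := ih
    refine ⟨b, b + (n + 3) * a, by omega, ?_, ?_, h2, ?_⟩
    · nlinarith
    · nlinarith
    · rw [show n + 1 + 3 = (n + 2) + 2 by ring, He_add_two, map_sub, map_mul, map_mul, h2, h1]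
      simp [h2']
      linear_combination (-Complex.I ^ (n + 2) * (n + 3) * a) * hI

lemma He_coeff_even (m j : ℕ) : ∃ z : ℤ,
    ((2 * (j + 2))! : ℤ) * (He (m + 2)).coeff (2 * (j + 2)) = m * ((He (m + 2)).coeff 0 * z) := by
  have h0 := He_coeff_add_two m 0
  have h2 := He_coeff_add_two m 2
  induction j with
  | zero =>
    refine ⟨m + 2, ?_⟩
    norm_num [Nat.factorial] at h0 h2 ⊢
    linear_combination 2 * h2 - m * h0
  | succ j ih =>
    obtain ⟨z, hz⟩ := ih
    have h := He_coeff_add_two m (2 * (j + 2))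
    refine ⟨(2 * (j + 2) - (m + 2)) * z, ?_⟩
    rw [show 2 * (j + 1 + 2) = 2 * (j + 2) + 1 + 1 by ring, Nat.factorial_succ, Nat.factorial_succ]
    push_cast at h ⊢
    linear_combination ((2 * (j + 2))! : ℤ) * h + (2 * (j + 2) - (m + 2)) * hz

lemma remainder_coeff {m : ℕ} {R : ℤ[X]}
    (hW : C (m : ℤ) * (X * R) = (X ^ 2 - 1) * derivative (He (m + 2)) - 2 * X * He (m + 2))
    (k : ℕ) :
    ((k : ℤ) + 1) * (m * R.coeff k) = (He (m + 2)).coeff k * (k * (k - 2) + m) := by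
  have h := congrArg (fun q => coeff q (k + 1)) hW
  rw [show (X ^ 2 - 1) * derivative (He (m + 2)) - 2 * X * He (m + 2)
    = X * (X * derivative (He (m + 2))) - derivative (He (m + 2)) - C 2 * (X * He (m + 2)) by
      simp; ring] at h
  simp only [coeff_sub, coeff_C_mul, coeff_X_mul, coeff_derivative] at h
  have ho := He_coeff_add_two m k
  rw [h]
  cases k with
  | zero =>
    simp at ho ⊢
    linarith
  | succ k =>
    rw [coeff_X_mul, coeff_derivative]
    rw [show k + 1 + 1 + 1 = k + 1 + 2 from rfl] at *
    push_cast at ho ⊢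
    linear_combination -ho

lemma remainder_map_zmod {m : ℕ} {R : ℤ[X]}
    (hW : C (m : ℤ) * (X * R) = (X ^ 2 - 1) * derivative (He (m + 2)) - 2 * X * He (m + 2))
    (p : ℕ) [Fact p.Prime] (hp2 : p ≠ 2) (hp : p ∣ m + 1) :
    R.map (Int.castRingHom (ZMod p)) = X ^ m * (X ^ 2 + 1) := by
  have hm1 : (m : (ZMod p)[X]) + 1 = 0 := by
    have : ((m + 1 : ℕ) : ZMod p) = 0 := (ZMod.natCast_eq_zero_iff _ _).2 hp
    have := congrArg (C (R := ZMod p)) this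
    simpa using this
  have h := congrArg (Polynomial.map (Int.castRingHom (ZMod p))) hW
  rw [show m + 2 = m + 1 + 1 by ring, derivative_He_succ] at h
  simp only [Polynomial.map_mul, Polynomial.map_sub, map_He_of_dvd p hp2 hp, map_He_add p hp] at h
  simp [He] at h
  refine mul_left_cancel₀ (X_ne_zero (R := ZMod p)) ?_
  linear_combination (-1 : (ZMod p)[X]) * h + (X * R.map (Int.castRingHom (ZMod p))
    - (X ^ 2 - 1) * X ^ (m + 1)) * hm1

lemma remainder_coeff_zero {m : ℕ} {R : ℤ[X]} (hm : 1 ≤ m)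
    (hW : C (m : ℤ) * (X * R) = (X ^ 2 - 1) * derivative (He (m + 2)) - 2 * X * He (m + 2)) :
    R.coeff 0 = (He (m + 2)).coeff 0 := by
  have h := remainder_coeff hW 0
  have hm' : (m : ℤ) ≠ 0 := by positivity
  apply mul_left_cancel₀ hm'
  push_cast at h
  linarith

lemma remainder_coeff_odd {m : ℕ} {R : ℤ[X]} (hm : 1 ≤ m)
    (hW : C (m : ℤ) * (X * R) = (X ^ 2 - 1) * derivative (He (m + 2)) - 2 * X * He (m + 2))
    (hme : Even m) (k : ℕ) (hk : Odd k) : R.coeff k = 0 := by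
  have h := remainder_coeff hW k
  rw [coeff_He_of_odd_add (by rw [Nat.odd_iff] at *; rw [Nat.even_iff] at hme; omega),
    zero_mul] at h
  have hm' : (m : ℤ) ≠ 0 := by positivity
  have hk' : (k : ℤ) + 1 ≠ 0 := by positivity
  simpa [show m ≠ 0 by omega, hk'] using h

lemma remainder_monic {m : ℕ} {R : ℤ[X]} (hm : 1 ≤ m)
    (hW : C (m : ℤ) * (X * R) = (X ^ 2 - 1) * derivative (He (m + 2)) - 2 * X * He (m + 2)) :
    R.Monic := by
  have hm' : (m : ℤ) ≠ 0 := by positivity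
  refine monic_of_natDegree_le_of_coeff_eq_one (m + 2) ?_ ?_
  · rw [natDegree_le_iff_coeff_eq_zero]
    intro k hk
    have h := remainder_coeff hW k
    rw [coeff_eq_zero_of_natDegree_lt ((natDegree_He_le _).trans_lt hk), zero_mul] at h
    have hk' : (k : ℤ) + 1 ≠ 0 := by positivity
    simpa [show m ≠ 0 by omega, hk'] using h
  · have h := remainder_coeff hW (m + 2)
    rw [coeff_He_self] at h
    have hk' : (m : ℤ) + 3 ≠ 0 := by positivity
    apply mul_left_cancel₀ hm'
    apply mul_left_cancel₀ hk'
    push_cast at h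
    linear_combination h

lemma remainder_factorial_mul_coeff {m : ℕ} {R : ℤ[X]} (hm : 1 ≤ m)
    (hW : C (m : ℤ) * (X * R) = (X ^ 2 - 1) * derivative (He (m + 2)) - 2 * X * He (m + 2))
    (j : ℕ) :
    ∃ z : ℤ, ((2 * j + 1)! : ℤ) * R.coeff (2 * j) = R.coeff 0 * z := by
  have hm' : (m : ℤ) ≠ 0 := by positivity
  rw [remainder_coeff_zero hm hW]
  match j with
  | 0 => exact ⟨1, by simp [remainder_coeff_zero hm hW]⟩
  | 1 =>
    have h := remainder_coeff hW 2
    have h0 := He_coeff_add_two m 0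
    refine ⟨-(m + 2), ?_⟩
    have key : (m : ℤ) * (6 * R.coeff 2) = m * ((He (m + 2)).coeff 0 * -(m + 2)) := by
      norm_num at h h0
      linear_combination 2 * h + m * h0
    simpa [Nat.factorial] using mul_left_cancel₀ hm' key
  | j + 2 =>
    obtain ⟨z, hz⟩ := He_coeff_even m j
    have h := remainder_coeff hW (2 * (j + 2))
    refine ⟨z * (2 * (j + 2) * (2 * (j + 2) - 2) + m), ?_⟩
    apply mul_left_cancel₀ hm'
    rw [Nat.factorial_succ]
    push_cast at h ⊢
    linear_combination ((2 * (j + 2))! : ℤ) * h + (2 * (j + 2) * (2 * (j + 2) - 2) + m) * hz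

lemma remainder_aeval_I_ne_zero {m : ℕ} {R : ℤ[X]} (hm : 1 ≤ m)
    (hW : C (m : ℤ) * (X * R) = (X ^ 2 - 1) * derivative (He (m + 2)) - 2 * X * He (m + 2)) :
    aeval Complex.I R ≠ 0 := by
  intro h
  obtain ⟨n, rfl⟩ : ∃ n, m = n + 1 := ⟨m - 1, by omega⟩
  obtain ⟨a, b, -, -, hb, h1, h2⟩ := He_eval_I n
  have h2' : aeval Complex.I (2 : ℤ[X]) = 2 := map_ofNat _ 2
  have e := congrArg (aeval Complex.I) hW
  rw [show n + 1 + 2 = n + 2 + 1 by ring, derivative_He_succ] at e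
  rw [show n + 2 + 1 = n + 3 by ring] at e
  simp only [map_mul, map_sub, h, h1, h2, map_pow, aeval_X, Complex.I_sq, map_one, h2',
    mul_zero, aeval_C] at e
  have hI : Complex.I ^ (n + 2) ≠ 0 := pow_ne_zero _ Complex.I_ne_zero
  have e' : Complex.I ^ (n + 2) * ((n + 3) * a - b) = 0 := by
    simp at e
    have hI2 := Complex.I_sq
    linear_combination (1 / 2 : ℂ) * e - Complex.I ^ (n + 2) * b * hI2
  rcases mul_eq_zero.1 e' with e' | e'
  · exact hI e'
  · have : ((n + 3) * a : ℕ) = b := by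
      have := sub_eq_zero.1 e'
      exact_mod_cast this
    omega

/-- An even polynomial divisible by `X ^ 2 + b * X + c`, whose reduction modulo `p` is
`X ^ m * (X ^ 2 + 1)`, forces `b = 0`, provided `p` does not divide `c`. -/
lemma linear_coeff_eq_zero_of_dvd {R : ℤ[X]} {m p : ℕ} [Fact p.Prime]
    (heven : R.comp (-X) = R)
    (hmap : R.map (Int.castRingHom (ZMod p)) = X ^ m * (X ^ 2 + 1))
    {b c : ℤ} (hg : X ^ 2 + C b * X + C c ∣ R) (hc : ¬ (p : ℤ) ∣ c) : b = 0 := by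
  by_contra hb
  have hc0 : c ≠ 0 := by rintro rfl; simp at hc
  have hg' : X ^ 2 - C b * X + C c ∣ R := by
    rw [← heven, dvd_comp_neg_X_iff]
    simpa [sub_eq_add_neg] using hg
  have hmon : (X ^ 2 - C b * X + C c : ℤ[X]).Monic := by monicity!
  have hmon' : (X ^ 2 + C b * X + C c : ℤ[X]).Monic := by monicity!
  have hinj : Function.Injective (Int.castRingHom ℚ) := Int.cast_injective
  have hprod : (X ^ 2 + C b * X + C c) * (X ^ 2 - C b * X + C c) ∣ R := by
    rw [← map_dvd_map _ hinj (hmon'.mul hmon), Polynomial.map_mul]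
    refine IsCoprime.mul_dvd ?_ ((map_dvd_map _ hinj hmon').2 hg) ((map_dvd_map _ hinj hmon).2 hg')
    have hbQ : (b : ℚ) ≠ 0 := by exact_mod_cast hb
    have hcQ : (c : ℚ) ≠ 0 := by exact_mod_cast hc0
    have hC : C ((c : ℚ)⁻¹) * C (c : ℚ) = 1 := by rw [← C_mul, inv_mul_cancel₀ hcQ, C_1]
    have hB : C ((b : ℚ)⁻¹) * C (b : ℚ) = 1 := by rw [← C_mul, inv_mul_cancel₀ hbQ, C_1]
    have h2 : C (2⁻¹ : ℚ) * 2 = 1 := by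
      rw [← C_ofNat, ← C_mul, ← C_1]; norm_num
    refine ⟨C ((c : ℚ)⁻¹) * (1 - C (2⁻¹ : ℚ) * C ((b : ℚ)⁻¹) * (X + C (b : ℚ))),
      C ((c : ℚ)⁻¹) * C (2⁻¹ : ℚ) * C ((b : ℚ)⁻¹) * (X + C (b : ℚ)), ?_⟩
    simp only [Polynomial.map_add, Polynomial.map_sub, Polynomial.map_mul, Polynomial.map_pow,
      map_X, map_C]
    simp only [eq_intCast]
    linear_combination hC
      - C ((c : ℚ)⁻¹) * (X + C (b : ℚ)) * X * C (b : ℚ) * C ((b : ℚ)⁻¹) * h2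
      - C ((c : ℚ)⁻¹) * (X + C (b : ℚ)) * X * hB
  have hcp : (c : ZMod p) ≠ 0 := by rwa [Ne, ZMod.intCast_zmod_eq_zero_iff_dvd]
  obtain ⟨q, hq⟩ := hprod
  have h := hmap.symm
  rw [hq] at h
  have hdvd : (X ^ 2 + C (b : ZMod p) * X + C (c : ZMod p))
      * (X ^ 2 - C (b : ZMod p) * X + C (c : ZMod p)) ∣ X ^ m * (X ^ 2 + 1) := by
    rw [h]
    refine ⟨q.map (Int.castRingHom (ZMod p)), ?_⟩
    simp
  have hcop : IsCoprime ((X ^ 2 + C (b : ZMod p) * X + C (c : ZMod p))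
      * (X ^ 2 - C (b : ZMod p) * X + C (c : ZMod p))) (X ^ m) := by
    have hC : C ((c : ZMod p)⁻¹) * C (c : ZMod p) = 1 := by
      rw [← C_mul, inv_mul_cancel₀ hcp, C_1]
    refine IsCoprime.pow_right (IsCoprime.mul_left
      ⟨C (c : ZMod p)⁻¹, - C (c : ZMod p)⁻¹ * (X + C (b : ZMod p)), ?_⟩
      ⟨C (c : ZMod p)⁻¹, - C (c : ZMod p)⁻¹ * (X - C (b : ZMod p)), ?_⟩)
    · linear_combination hC
    · linear_combination hC
  have hdvd' := hcop.dvd_of_dvd_mul_left hdvd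
  have hne : (X ^ 2 + 1 : (ZMod p)[X]) ≠ 0 :=
    (show (X ^ 2 + 1 : (ZMod p)[X]).Monic by monicity!).ne_zero
  have hdeg := natDegree_le_of_dvd hdvd' hne
  have e1 : (X ^ 2 + 1 : (ZMod p)[X]).natDegree = 2 := by compute_degree!
  have e2 : ((X ^ 2 + C (b : ZMod p) * X + C (c : ZMod p))
      * (X ^ 2 - C (b : ZMod p) * X + C (c : ZMod p))).natDegree = 4 := by
    rw [Monic.natDegree_mul (by monicity!) (by monicity!)]
    have : (X ^ 2 + C (b : ZMod p) * X + C (c : ZMod p)).natDegree = 2 := by compute_degree!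
    have : (X ^ 2 - C (b : ZMod p) * X + C (c : ZMod p)).natDegree = 2 := by compute_degree!
    omega
  omega

lemma intCast_eq_one_of_X_sq_add_C_dvd {R : ℤ[X]} {m p : ℕ} [Fact p.Prime]
    (hmap : R.map (Int.castRingHom (ZMod p)) = X ^ m * (X ^ 2 + 1))
    {c : ℤ} (hg : X ^ 2 + C c ∣ R) (hc : ¬ (p : ℤ) ∣ c) : (p : ℤ) ∣ c - 1 := by
  have hcp : (c : ZMod p) ≠ 0 := by rwa [Ne, ZMod.intCast_zmod_eq_zero_iff_dvd]
  have hdvd : X ^ 2 + C (c : ZMod p) ∣ X ^ m * (X ^ 2 + 1) := by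
    rw [← hmap]
    obtain ⟨q, rfl⟩ := hg
    exact ⟨q.map (Int.castRingHom (ZMod p)), by simp⟩
  have hC : C ((c : ZMod p)⁻¹) * C (c : ZMod p) = 1 := by
    rw [← C_mul, inv_mul_cancel₀ hcp, C_1]
  have hcop : IsCoprime (X ^ 2 + C (c : ZMod p)) (X ^ m) :=
    IsCoprime.pow_right ⟨C (c : ZMod p)⁻¹, - C (c : ZMod p)⁻¹ * X, by linear_combination hC⟩
  have hsub : X ^ 2 + C (c : ZMod p) ∣ C ((c - 1 : ℤ) : ZMod p) := by
    have := dvd_sub (dvd_refl (X ^ 2 + C (c : ZMod p))) (hcop.dvd_of_dvd_mul_left hdvd)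
    simpa using this
  rw [← ZMod.intCast_zmod_eq_zero_iff_dvd]
  by_contra hne
  have h1 := natDegree_le_of_dvd hsub (C_ne_zero.2 hne)
  rw [natDegree_C, natDegree_X_pow_add_C] at h1
  omega

/-- An odd integer without prime factors `≥ 5` and not divisible by `9` divides `3`. -/
lemma dvd_three_of_forall_prime {c : ℤ} (hodd : Odd c) (h9 : ¬ (9 : ℤ) ∣ c)
    (h5 : ∀ p : ℕ, p.Prime → 5 ≤ p → ¬ (p : ℤ) ∣ c) : c ∣ 3 := by
  have hc0 : c ≠ 0 := by rintro rfl; simp at h9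
  have h := Nat.eq_prime_pow_of_unique_prime_dvd (n := c.natAbs) (p := 3)
    (Int.natAbs_ne_zero.2 hc0) (fun {q} hq hqc => by
      by_contra hq3
      rw [← Int.natCast_dvd] at hqc
      have h2 := hq.two_le
      rcases Nat.lt_or_ge q 5 with hlt | hge
      · interval_cases q
        · rw [Int.odd_iff] at hodd
          have : (2 : ℤ) ∣ c := by exact_mod_cast hqc
          omega
        · exact hq3 rfl
        · revert hq; decide
      · exact h5 q hq hge hqc)
  rw [← Int.natAbs_dvd_natAbs, h]
  generalize c.natAbs.primeFactorsList.length = k at h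
  match k with
  | 0 => simp
  | 1 => simp
  | k + 2 =>
    exfalso
    apply h9
    rw [← Int.natAbs_dvd_natAbs, h]
    exact ⟨3 ^ k, by simp; ring⟩

lemma exists_prime_five_le_dvd_two_pow_sub_one {M l : ℕ} (hl : M + 1 = 2 ^ l) (hl3 : 3 ≤ l) :
    ∃ p : ℕ, p.Prime ∧ 5 ≤ p ∧ p ∣ M := by
  by_contra! hno
  obtain ⟨k, rfl⟩ : ∃ k, l = k + 3 := ⟨l - 3, by omega⟩
  have hM : M % 8 = 7 := by rw [pow_add] at hl; have := Nat.one_le_two_pow (n := k); omega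
  have h := Nat.eq_prime_pow_of_unique_prime_dvd (n := M) (p := 3) (by omega)
    (fun {q} hq hqc => by
      by_contra hq3
      have h2 := hq.two_le
      rcases Nat.lt_or_ge q 5 with hlt | hge
      · interval_cases q
        · omega
        · exact hq3 rfl
        · revert hq; decide
      · exact hno q hq hge hqc)
  generalize M.primeFactorsList.length = k at h
  have h3 : ∀ k, 3 ^ k % 8 = 1 ∨ 3 ^ k % 8 = 3 := by
    intro k
    induction k with
    | zero => simp
    | succ k ih => rw [pow_succ]; omega
  have := h3 k
  omega

/-- A factor of degree one or two of an even monic polynomial with nonzero constant coefficient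
yields a monic quadratic factor. -/
lemma exists_quadratic_dvd {R g : ℤ[X]} (hR : R.Monic) (heven : R.comp (-X) = R)
    (h0 : R.coeff 0 ≠ 0) (hg : g ∣ R) (h1 : 1 ≤ g.natDegree) (h2 : g.natDegree ≤ 2) :
    ∃ b c : ℤ, X ^ 2 + C b * X + C c ∣ R := by
  obtain ⟨q, hq⟩ := hg
  have hlc : g.leadingCoeff * q.leadingCoeff = 1 := by rw [← leadingCoeff_mul, ← hq]; exact hR
  have hlc2 : g.leadingCoeff * g.leadingCoeff = 1 := by
    rcases Int.isUnit_iff.1 (IsUnit.of_mul_eq_one _ hlc) with h | h <;> rw [h] <;> rfl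
  have hC : C g.leadingCoeff * C g.leadingCoeff = 1 := by rw [← C_mul, hlc2, C_1]
  have hdvd : C g.leadingCoeff * g ∣ R := by
    refine ⟨C g.leadingCoeff * q, ?_⟩
    rw [hq]
    linear_combination (-(g * q)) * hC
  obtain hd | hd : g.natDegree = 1 ∨ g.natDegree = 2 := by omega
  · have hg : C g.leadingCoeff * g = X + C (g.leadingCoeff * g.coeff 0) := by
      have e : g = C g.leadingCoeff * X + C (g.coeff 0) := by
        have := eq_X_add_C_of_natDegree_le_one hd.le
        rwa [show g.coeff 1 = g.leadingCoeff by rw [leadingCoeff, hd]] at this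
      rw [C_mul]
      linear_combination C g.leadingCoeff * e + X * hC
    rw [hg] at hdvd
    set a := g.leadingCoeff * g.coeff 0
    have hroot : R.eval (-a) = 0 := by
      obtain ⟨s, hs⟩ := hdvd
      rw [hs]; simp
    have hroot' : R.eval a = 0 := by
      rw [← heven, eval_comp]; simpa using hroot
    have ha : a ≠ 0 := by
      intro ha
      rw [ha, ← coeff_zero_eq_eval_zero] at hroot'
      exact h0 hroot'
    obtain ⟨s, hs⟩ := hdvd
    have hsa : s.eval a = 0 := by
      rw [hs, eval_mul] at hroot'
      rcases mul_eq_zero.1 hroot' with h | h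
      · simp at h; omega
      · exact h
    obtain ⟨t, ht⟩ := dvd_iff_isRoot.2 hsa
    refine ⟨0, -a ^ 2, t, ?_⟩
    rw [hs, ht]
    simp
    ring
  · refine ⟨g.leadingCoeff * g.coeff 1, g.leadingCoeff * g.coeff 0, ?_⟩
    convert hdvd using 1
    have e : g = C g.leadingCoeff * X ^ 2 + C (g.coeff 1) * X + C (g.coeff 0) := by
      have := eq_quadratic_of_degree_le_two (natDegree_le_iff_degree_le.1 hd.le)
      rwa [show g.coeff 2 = g.leadingCoeff by rw [leadingCoeff, hd]] at this
    rw [C_mul, C_mul]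
    linear_combination -C g.leadingCoeff * e - X ^ 2 * hC

theorem stmt19 (n : ℕ) (hn : 1000 ≤ n) (l : ℕ) (hl : n + 1 = 2 ^ l)
    (HeL RL : Polynomial ℤ)
    (hHe : Polynomial.C (vand (degSeq ![n, 2])) * HeL = wronskHe (degSeq ![n, 2]))
    (hR : HeL = Polynomial.X ^ sStat (degSeq ![n, 2]) * RL)
    (hR0 : RL.coeff 0 ≠ 0) :
    ∀ d : ℕ, 1 ≤ d → d ≤ 2 →
      ¬ ∃ g : Polynomial ℤ, g.natDegree = d ∧ g ∣ RL := by
  rintro d hd1 hd2 ⟨g, rfl, hg⟩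
  have hl3 : 3 ≤ l := by
    by_contra! h
    interval_cases l <;> omega
  have hn_even : Even (n + 1) := by
    rw [hl]; exact (even_two).pow_of_ne_zero (by omega)
  obtain ⟨m, rfl⟩ : ∃ m, n = m + 1 := ⟨n - 1, by omega⟩
  have hm : 1 ≤ m := by omega
  have hme : Even m := by rw [Nat.even_iff] at *; omega
  have hdeg : degSeq ![m + 1, 2] = ![2, m + 2] := by
    funext i; fin_cases i <;> rfl
  have hs : sStat ![2, m + 2] = 1 := by
    have hodd : ¬ Odd (m + 2) := by rw [Nat.not_odd_iff_even]; exact hn_even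
    have e1 : (Finset.univ.filter fun i => Odd (![2, m + 2] i)) = ∅ := by
      ext i; fin_cases i
      · simp
      · simpa using hodd
    have e2 : (Finset.univ.filter fun i => Even (![2, m + 2] i)) = Finset.univ := by
      ext i; fin_cases i
      · simp
      · simpa using hn_even
    rw [sStat, dStat, e1, e2]
    rfl
  have hv : vand ![2, m + 2] = m := by
    simp [vand, Fin.prod_univ_two, show Iio (1 : Fin 2) = {0} from rfl,
      show Iio (0 : Fin 2) = ∅ from rfl]
  have hw : wronskHe ![2, m + 2]
      = (X ^ 2 - 1) * derivative (He (m + 2)) - 2 * X * He (m + 2) := by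
    have h2 : He 2 = X ^ 2 - 1 := by rw [He_add_two 0]; simp [He]; ring
    rw [wronskHe, Matrix.det_fin_two]
    simp [h2]
    ring
  rw [hdeg] at hHe hR
  rw [hv, hw, hR, hs, pow_one] at hHe
  have hodd := remainder_coeff_odd hm hHe hme
  have hmon := remainder_monic hm hHe
  have hz := remainder_factorial_mul_coeff hm hHe
  have heven : RL.comp (-X) = RL := by
    ext k
    rw [show (-X : ℤ[X]) = C (-1) * X by simp, comp_C_mul_X_coeff]
    rcases Nat.even_or_odd k with hk | hk
    · simp [hk.neg_one_pow]
    · simp [hodd k hk]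
  obtain ⟨b, c, hbc⟩ := exists_quadratic_dvd hmon heven hR0 hg hd1 hd2
  have hp5 : ∀ p : ℕ, p.Prime → 5 ≤ p → ¬ (p : ℤ) ∣ c := by
    intro p hp h5
    have := Fact.mk hp
    rw [← pow_one (p : ℤ)]
    refine not_pow_dvd_coeff_zero_of_dvd p ?_ hodd hR0 hz hbc
    intro j hj
    have h := sub_one_mul_padicValNat_factorial_odd_le (p := p) j
    have : 4 * padicValNat p (2 * j + 1)! ≤ 2 * j := (Nat.mul_le_mul_right _ (by omega)).trans h
    omega
  have h9 : ¬ (9 : ℤ) ∣ c := by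
    refine not_pow_dvd_coeff_zero_of_dvd 3 (e := 2) ?_ hodd hR0 hz hbc
    intro j hj
    have h := sub_one_mul_padicValNat_factorial_odd_le (p := 3) j
    omega
  have hc_odd : Odd c := by
    obtain ⟨m', rfl⟩ := even_iff_two_dvd.1 hme
    have h0 := odd_coeff_zero_He (m' + 1)
    rw [show 2 * (m' + 1) = 2 * m' + 2 by ring, ← remainder_coeff_zero hm hHe] at h0
    obtain ⟨q, hq⟩ := hbc
    rw [hq, mul_coeff_zero] at h0
    simpa using (Int.odd_mul.1 h0).1
  have hc3 := dvd_three_of_forall_prime hc_odd h9 hp5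
  obtain ⟨p, hp, h5, hpm⟩ := exists_prime_five_le_dvd_two_pow_sub_one hl hl3
  have := Fact.mk hp
  have hmap := remainder_map_zmod hHe p (by omega) hpm
  have hb := linear_coeff_eq_zero_of_dvd heven hmap hbc (hp5 p hp h5)
  subst hb
  have hc : X ^ 2 + C c ∣ RL := by simpa using hbc
  have hpc := intCast_eq_one_of_X_sq_add_C_dvd hmap hc (hp5 p hp h5)
  have hc1 : c = 1 := by
    have hle := Int.le_of_dvd (by norm_num) hc3
    have hle' := Int.le_of_dvd (by norm_num) ((neg_dvd).2 hc3)
    by_contra hne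
    have h := Int.le_of_dvd (abs_pos.2 (sub_ne_zero.2 hne)) ((dvd_abs _ _).2 hpc)
    have h4 : |c - 1| ≤ 4 := abs_le.2 ⟨by omega, by omega⟩
    omega
  subst hc1
  refine remainder_aeval_I_ne_zero hm hHe ?_
  obtain ⟨q, rfl⟩ := hc
  simp
end
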